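/- arXiv:1701.02076 — 3 statements merged into one kernel-verified Lean document; each statement's English description precedes it below -/
import Mathlib

section
/- For every Coxeter group W, the algebra Ĥ(W) admits a Hopf algebra structure over ℤ: there exist a ℤ-algebra homomorphism Δ : Ĥ(W) → Ĥ(W) ⊗_ℤ Ĥ(W), a ℤ-algebra homomorphism ε : Ĥ(W) → ℤ, and a ℤ-algebra anti-homomorphism S : Ĥ(W) → Ĥ(W) making Ĥ(W) a Hopf algebra over ℤ and satisfying, for all i ∈ I: Δ(s_i) = s_i ⊗ s_i, Δ(D_i) = D_i ⊗ 1 + s_i ⊗ D_i, ε(s_i) = 1, ε(D_i) = 0, S(s_i) = s_i, S(D_i) = −s_i·D_i. -/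
open scoped TensorProduct

namespace HeckeHopfCox

/-- Generators of `Ĥ(W)`: `s i` and `D i` for `i ∈ I`. -/
inductive Gen (B : Type*) : Type _
  | s : B → Gen B
  | D : B → Gen B

/-- The free `ℤ`-algebra on the generators. -/
abbrev F (B : Type*) : Type _ := FreeAlgebra ℤ (Gen B)

noncomputable def fs {B : Type*} (i : B) : F B := FreeAlgebra.ι ℤ (Gen.s i)
noncomputable def fD {B : Type*} (i : B) : F B := FreeAlgebra.ι ℤ (Gen.D i)

/-- The alternating word `sᵢ sⱼ sᵢ ⋯` with `k` factors, starting with `sᵢ`. -/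
noncomputable def altS {B : Type*} (i j : B) : ℕ → F B
  | 0 => 1
  | k + 1 => fs i * altS j i k

/-- The defining relations of `Ĥ(W)`: (i) rank-one relations; (ii) Coxeter relations;
(iii) the linear braid relations `Dᵢ·(sⱼsᵢ⋯s_{j'}) = (sⱼ⋯s_{i'}s_{j'})·D_{i'}`, where the
alternating word has `m_{ij} - 1` factors starting with `sⱼ`, and `i' = i` if `m_{ij}` is
even and `i' = j` if `m_{ij}` is odd. -/
inductive Rel {B : Type*} (M : CoxeterMatrix B) : F B → F B → Prop
  | s_sq (i : B) : Rel M (fs i * fs i) 1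
  | D_sq (i : B) : Rel M (fD i * fD i) (fD i)
  | sD (i : B) : Rel M (fs i * fD i + fD i * fs i) (fs i - 1)
  | coxeter (i j : B) : Rel M ((fs i * fs j) ^ M i j) 1
  | braidLin (i j : B) : i ≠ j → M i j ≠ 0 →
      Rel M (fD i * altS j i (M i j - 1))
        (altS j i (M i j - 1) * fD (if M i j % 2 = 0 then i else j))

/-- The algebra `Ĥ(W)` associated to a Coxeter matrix. -/
abbrev HW {B : Type*} (M : CoxeterMatrix B) : Type _ := RingQuot (Rel M)

/-- The image of the generator `sᵢ` in `Ĥ(W)`. -/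
noncomputable def hs {B : Type*} (M : CoxeterMatrix B) (i : B) : HW M :=
  RingQuot.mkAlgHom ℤ (Rel M) (fs i)

/-- The image of the generator `Dᵢ` in `Ĥ(W)`. -/
noncomputable def hD {B : Type*} (M : CoxeterMatrix B) (i : B) : HW M :=
  RingQuot.mkAlgHom ℤ (Rel M) (fD i)

/-- The set of reflections of the Coxeter group `W`, as a subtype. -/
abbrev Refl {B : Type*} (M : CoxeterMatrix B) : Type _ :=
  {t : M.Group // M.toCoxeterSystem.IsReflection t}

/-- A Hopf algebra structure on an `R`-algebra `A`: an algebra-homomorphism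
comultiplication and counit and an anti-homomorphism antipode, satisfying the
coassociativity, counit and antipode axioms. -/
structure HopfAlgStruct (R : Type*) (A : Type*) [CommRing R] [Ring A] [Algebra R A] where
  comul : A →ₐ[R] A ⊗[R] A
  counit : A →ₐ[R] R
  antipode : A →ₗ[R] A
  antipode_one : antipode 1 = 1
  antipode_mul : ∀ x y : A, antipode (x * y) = antipode y * antipode x
  coassoc : ∀ x : A,
    (TensorProduct.assoc R A A A) ((Algebra.TensorProduct.map comul (AlgHom.id R A)) (comul x)) =
      (Algebra.TensorProduct.map (AlgHom.id R A) comul) (comul x)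
  counit_comul : ∀ x : A,
    (TensorProduct.lid R A) ((LinearMap.rTensor A counit.toLinearMap) (comul x)) = x
  comul_counit : ∀ x : A,
    (TensorProduct.rid R A) ((LinearMap.lTensor A counit.toLinearMap) (comul x)) = x
  mul_antipode_rTensor_comul : ∀ x : A,
    (LinearMap.mul' R A) ((LinearMap.rTensor A antipode) (comul x)) = algebraMap R A (counit x)
  mul_antipode_lTensor_comul : ∀ x : A,
    (LinearMap.mul' R A) ((LinearMap.lTensor A antipode) (comul x)) = algebraMap R A (counit x)

section

variable {B : Type*} (M : CoxeterMatrix B)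

/-- A copy of `Ĥ(W)` whose only instances are its ring and its `ℤ`-algebra structure. -/
def Alg : Type _ := HW M

noncomputable instance : Ring (Alg M) := inferInstanceAs (Ring (HW M))

noncomputable instance : Algebra ℤ (Alg M) := inferInstanceAs (Algebra ℤ (HW M))

/-- The `ℤ`-module structure coming from the algebra structure, preferred over the one of the
additive group. -/
noncomputable local instance (priority := high) Alg.instModule : Module ℤ (Alg M) := Algebra.toModule

noncomputable local instance (priority := high) Alg.instSMul : SMul ℤ (Alg M) := Algebra.toSMul

/-- The quotient map from the free algebra. -/
noncomputable def Alg.mk : F B →ₐ[ℤ] Alg M := RingQuot.mkAlgHom ℤ (Rel M)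

variable {M} in
theorem Alg.mk_rel {x y : F B} (h : Rel M x y) : Alg.mk M x = Alg.mk M y :=
  RingQuot.mkAlgHom_rel ℤ h

variable {M} in
/-- The homomorphism induced by a homomorphism on the free algebra respecting the relations. -/
noncomputable def Alg.lift {A : Type*} [Ring A] [Algebra ℤ A] (f : F B →ₐ[ℤ] A)
    (h : ∀ ⦃x y⦄, Rel M x y → f x = f y) : Alg M →ₐ[ℤ] A :=
  RingQuot.liftAlgHom ℤ ⟨f, h⟩

@[simp]
theorem Alg.lift_mk {A : Type*} [Ring A] [Algebra ℤ A] (f : F B →ₐ[ℤ] A)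
    (h : ∀ ⦃x y⦄, Rel M x y → f x = f y) (x : F B) : Alg.lift f h (Alg.mk M x) = f x :=
  RingQuot.liftAlgHom_mkAlgHom_apply _ _ _ _

/-- The image of the generator `sᵢ`. -/
noncomputable def Alg.s (i : B) : Alg M := Alg.mk M (fs i)

/-- The image of the generator `Dᵢ`. -/
noncomputable def Alg.D (i : B) : Alg M := Alg.mk M (fD i)

open Alg (s D)

theorem s_mul_self (i : B) : s M i * s M i = 1 := by
  simpa [s] using Alg.mk_rel (Rel.s_sq (M := M) i)

theorem s_mul_s_mul (i : B) (x : Alg M) : s M i * (s M i * x) = x := by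
  rw [← mul_assoc, s_mul_self, one_mul]

theorem D_mul_self (i : B) : D M i * D M i = D M i := by
  simpa [D] using Alg.mk_rel (Rel.D_sq (M := M) i)

theorem s_mul_D_add (i : B) : s M i * D M i + D M i * s M i = s M i - 1 := by
  simpa [D, s] using Alg.mk_rel (Rel.sD (M := M) i)

theorem D_mul_s (i : B) : D M i * s M i = s M i - 1 - s M i * D M i := by
  rw [← s_mul_D_add]; abel

theorem s_mul_s_pow (i j : B) : (s M i * s M j) ^ M i j = 1 := by
  simpa [s] using Alg.mk_rel (Rel.coxeter (M := M) i j)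

/-- The image of the alternating word `sᵢ sⱼ sᵢ ⋯` with `k` factors in `Ĥ(W)`. -/
noncomputable def hAlt (i j : B) (k : ℕ) : Alg M := Alg.mk M (altS i j k)

@[simp]
theorem hAlt_zero (i j : B) : hAlt M i j 0 = 1 := by simp [hAlt, altS]

theorem hAlt_succ (i j : B) (k : ℕ) : hAlt M i j (k + 1) = s M i * hAlt M j i k := by
  simp [hAlt, altS, s]

theorem hAlt_succ_right (i j : B) (k : ℕ) :
    hAlt M i j (k + 1) = hAlt M i j k * s M (if k % 2 = 0 then i else j) := by
  induction k generalizing i j with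
  | zero => simp [hAlt_succ]
  | succ k ih =>
    rw [hAlt_succ, ih, hAlt_succ, mul_assoc]
    rcases Nat.mod_two_eq_zero_or_one k with h | h <;> simp [h, Nat.add_mod]

theorem hAlt_two_mul (i j : B) (k : ℕ) : hAlt M i j (2 * k) = (s M i * s M j) ^ k := by
  induction k with
  | zero => simp
  | succ k ih => rw [mul_add, mul_one, hAlt_succ, hAlt_succ, ih, pow_succ', mul_assoc]

theorem hAlt_eq_of_add {i j : B} {k l : ℕ} (h₁ : hAlt M i j (k + l) = 1)
    (h₂ : hAlt M j i (k + l) = 1) : hAlt M i j l = hAlt M j i k := by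
  induction k generalizing i j l with
  | zero => simpa using h₁
  | succ k ih =>
    have h : k + 1 + l = k + (l + 1) := by omega
    rw [h] at h₁ h₂
    rw [hAlt_succ, ← ih h₂ h₁, hAlt_succ, s_mul_s_mul]

theorem hAlt_braid (i j : B) : hAlt M i j (M i j) = hAlt M j i (M i j) := by
  apply hAlt_eq_of_add
  · rw [← two_mul, hAlt_two_mul, s_mul_s_pow]
  · rw [← two_mul, hAlt_two_mul, M.symmetric i j, s_mul_s_pow]

theorem s_mul_hAlt (i j : B) (hm : M i j ≠ 0) :
    s M i * hAlt M j i (M i j - 1) =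
      hAlt M j i (M i j - 1) * s M (if M i j % 2 = 0 then i else j) := by
  have h := hAlt_braid M i j
  obtain ⟨k, hk⟩ := Nat.exists_eq_succ_of_ne_zero hm
  rw [hk, Nat.succ_eq_add_one] at h ⊢
  rw [hAlt_succ, hAlt_succ_right] at h
  rw [Nat.add_sub_cancel, h]
  rcases Nat.mod_two_eq_zero_or_one k with h | h <;> simp [h, Nat.add_mod]

theorem D_mul_hAlt (i j : B) (hij : i ≠ j) (hm : M i j ≠ 0) :
    D M i * hAlt M j i (M i j - 1) =
      hAlt M j i (M i j - 1) * D M (if M i j % 2 = 0 then i else j) := by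
  simpa [D, hAlt] using Alg.mk_rel (Rel.braidLin (M := M) i j hij hm)

variable {M} in
theorem Alg.induction {p : Alg M → Prop} (hsM : ∀ i, p (s M i)) (hDM : ∀ i, p (D M i))
    (hz : ∀ n : ℤ, p (algebraMap ℤ (Alg M) n)) (hadd : ∀ x y, p x → p y → p (x + y))
    (hmul : ∀ x y, p x → p y → p (x * y)) (x : Alg M) : p x := by
  obtain ⟨x, rfl⟩ := (RingQuot.mkAlgHom_surjective ℤ (Rel M) x :)
  refine FreeAlgebra.induction ℤ (Gen B)
    (motive := fun x => p (Alg.mk M x)) ?_ ?_ ?_ ?_ x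
  · intro n
    rw [AlgHom.commutes]
    exact hz n
  · rintro (i | i)
    · exact hsM i
    · exact hDM i
  · intro a b ha hb
    rw [map_mul]
    exact hmul _ _ ha hb
  · intro a b ha hb
    rw [map_add]
    exact hadd _ _ ha hb

variable {M} in
theorem Alg.algHom_ext {A : Type*} [Ring A] [Algebra ℤ A] {f g : Alg M →ₐ[ℤ] A}
    (h₁ : ∀ i, f (s M i) = g (s M i)) (h₂ : ∀ i, f (D M i) = g (D M i)) : f = g := by
  refine AlgHom.ext fun x => ?_
  induction x using Alg.induction with
  | hsM i => exact h₁ i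
  | hDM i => exact h₂ i
  | hz n => rw [AlgHom.commutes, AlgHom.commutes]
  | hadd x y hx hy => rw [map_add, map_add, hx, hy]
  | hmul x y hx hy => rw [map_mul, map_mul, hx, hy]

/-- The algebra homomorphism on the free algebra with prescribed values on the generators. -/
noncomputable def freeLift {A : Type*} [Ring A] [Algebra ℤ A] (a d : B → A) : F B →ₐ[ℤ] A :=
  FreeAlgebra.lift ℤ (fun g => match g with
    | Gen.s i => a i
    | Gen.D i => d i)

section freeLift

variable {A : Type*} [Ring A] [Algebra ℤ A] (a d : B → A)

@[simp]
theorem freeLift_fs (i : B) : freeLift a d (fs i) = a i := by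
  simp [freeLift, fs]

@[simp]
theorem freeLift_fD (i : B) : freeLift a d (fD i) = d i := by
  simp [freeLift, fD]

end freeLift

/-- The values of the comultiplication on the generators, extended to the free algebra. -/
noncomputable def comulFree : F B →ₐ[ℤ] Alg M ⊗[ℤ] Alg M :=
  freeLift (fun i => s M i ⊗ₜ[ℤ] s M i) (fun i => D M i ⊗ₜ[ℤ] 1 + s M i ⊗ₜ[ℤ] D M i)

theorem comulFree_altS (i j : B) (k : ℕ) :
    comulFree M (altS i j k) = hAlt M i j k ⊗ₜ[ℤ] hAlt M i j k := by
  induction k generalizing i j with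
  | zero => simp [altS, Algebra.TensorProduct.one_def]
  | succ k ih =>
    rw [altS, map_mul, ih, hAlt_succ, ← Algebra.TensorProduct.tmul_mul_tmul]
    simp [comulFree]

theorem comulFree_rel {x y : F B} (h : Rel M x y) : comulFree M x = comulFree M y := by
  induction h with
  | s_sq i => simp [comulFree, s_mul_self, Algebra.TensorProduct.one_def]
  | D_sq i =>
    simp only [comulFree, map_mul, freeLift_fD, mul_add, add_mul,
      Algebra.TensorProduct.tmul_mul_tmul, mul_one, one_mul, s_mul_self, D_mul_self]
    rw [D_mul_s, TensorProduct.sub_tmul, TensorProduct.sub_tmul]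
    abel
  | sD i =>
    simp only [comulFree, map_mul, map_add, map_sub, map_one, freeLift_fD, freeLift_fs, mul_add,
      add_mul, Algebra.TensorProduct.tmul_mul_tmul, mul_one, one_mul, s_mul_self, D_mul_s,
      TensorProduct.sub_tmul, TensorProduct.tmul_sub, Algebra.TensorProduct.one_def]
    abel
  | coxeter i j =>
    simp [comulFree, Algebra.TensorProduct.tmul_pow, s_mul_s_pow, Algebra.TensorProduct.one_def]
  | braidLin i j hij hm =>
    rw [map_mul, map_mul, comulFree_altS]
    simp only [comulFree, freeLift_fD, mul_add, add_mul, Algebra.TensorProduct.tmul_mul_tmul,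
      mul_one, one_mul, s_mul_hAlt M i j hm, D_mul_hAlt M i j hij hm]

/-- The comultiplication of `Ĥ(W)`. -/
noncomputable def comulHom : Alg M →ₐ[ℤ] Alg M ⊗[ℤ] Alg M :=
  Alg.lift (comulFree M) fun _ _ => comulFree_rel M

@[simp]
theorem comulHom_s (i : B) : comulHom M (s M i) = s M i ⊗ₜ[ℤ] s M i := by
  simp [comulHom, s, comulFree]

@[simp]
theorem comulHom_D (i : B) :
    comulHom M (D M i) = D M i ⊗ₜ[ℤ] 1 + s M i ⊗ₜ[ℤ] D M i := by
  simp [comulHom, D, s, comulFree]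

/-- The counit of `Ĥ(W)`. -/
noncomputable def counitHom : Alg M →ₐ[ℤ] ℤ :=
  Alg.lift (freeLift (fun _ => 1) (fun _ => 0)) fun _ _ h => by
    induction h <;> simp

@[simp]
theorem counitHom_s (i : B) : counitHom M (s M i) = 1 := by
  simp [counitHom, s]

@[simp]
theorem counitHom_D (i : B) : counitHom M (D M i) = 0 := by
  simp [counitHom, D]

/-- The values of the antipode on the generators, extended to the free algebra. -/
noncomputable def antipodeFree : F B →ₐ[ℤ] (Alg M)ᵐᵒᵖ :=
  freeLift (fun i => .op (s M i)) (fun i => .op (-(s M i * D M i)))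

theorem antipodeFree_altS (i j : B) (k : ℕ) :
    (antipodeFree M (altS i j k)).unop * hAlt M i j k = 1 ∧
      hAlt M i j k * (antipodeFree M (altS i j k)).unop = 1 := by
  induction k generalizing i j with
  | zero => simp [altS]
  | succ k ih =>
    have h : (antipodeFree M (fs i)).unop = s M i := by simp [antipodeFree]
    rw [altS, map_mul, MulOpposite.unop_mul, h, hAlt_succ]
    constructor
    · rw [mul_assoc, s_mul_s_mul, (ih j i).1]
    · rw [mul_assoc, ← mul_assoc (hAlt M j i k), (ih j i).2, one_mul, s_mul_self]

theorem antipodeFree_rel {x y : F B} (h : Rel M x y) : antipodeFree M x = antipodeFree M y := by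
  apply MulOpposite.unop_injective
  induction h with
  | s_sq i => simp [antipodeFree, s_mul_self]
  | D_sq i =>
    simp only [antipodeFree, map_mul, freeLift_fD, MulOpposite.unop_mul, MulOpposite.unop_op,
      neg_mul_neg]
    rw [mul_assoc, ← mul_assoc (D M i), D_mul_s]
    simp only [sub_mul, mul_sub, mul_assoc, s_mul_s_mul, D_mul_self, one_mul]
    abel
  | sD i =>
    simp only [antipodeFree, map_mul, map_add, map_sub, map_one, freeLift_fD, freeLift_fs,
      MulOpposite.unop_mul, MulOpposite.unop_op, MulOpposite.unop_add, MulOpposite.unop_sub,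
      MulOpposite.unop_one, neg_mul, mul_neg, mul_assoc, s_mul_s_mul, D_mul_s, mul_sub,
      s_mul_self, mul_one]
    abel
  | coxeter i j =>
    simp [antipodeFree, ← MulOpposite.op_mul, M.symmetric i j, s_mul_s_pow]
  | braidLin i j hij hm =>
    obtain ⟨h₁, h₂⟩ := antipodeFree_altS M j i (M i j - 1)
    rw [map_mul, map_mul, MulOpposite.unop_mul, MulOpposite.unop_mul]
    generalize (antipodeFree M (altS j i (M i j - 1))).unop = v at *
    have hs' := s_mul_hAlt M i j hm
    have hD' := D_mul_hAlt M i j hij hm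
    generalize hAlt M j i (M i j - 1) = u at *
    simp only [antipodeFree, freeLift_fD, MulOpposite.unop_op, mul_neg, neg_mul, neg_inj]
    generalize (if M i j % 2 = 0 then i else j) = l at *
    calc v * (s M i * D M i) = v * (s M i * D M i) * (u * v) := by rw [h₂, mul_one]
      _ = v * (s M i * (D M i * u)) * v := by simp only [mul_assoc]
      _ = v * (s M i * u * D M l) * v := by rw [hD', mul_assoc (s M i)]
      _ = v * u * (s M l * D M l) * v := by rw [hs']; simp only [mul_assoc]
      _ = s M l * D M l * v := by rw [h₁, one_mul]

/-- The antipode of `Ĥ(W)`, as a homomorphism to the opposite algebra. -/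
noncomputable def antipodeHom : Alg M →ₐ[ℤ] (Alg M)ᵐᵒᵖ :=
  Alg.lift (antipodeFree M) fun _ _ => antipodeFree_rel M

/-- The antipode of `Ĥ(W)`, as a linear map. -/
noncomputable def antipodeLin : Alg M →ₗ[ℤ] Alg M :=
  (MulOpposite.opLinearEquiv ℤ).symm.toLinearMap ∘ₗ (antipodeHom M).toLinearMap

@[simp]
theorem antipodeLin_one : antipodeLin M 1 = 1 := by simp [antipodeLin]

theorem antipodeLin_mul (x y : Alg M) :
    antipodeLin M (x * y) = antipodeLin M y * antipodeLin M x := by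
  simp [antipodeLin]

@[simp]
theorem antipodeLin_s (i : B) : antipodeLin M (s M i) = s M i := by
  simp [antipodeLin, antipodeHom, s, antipodeFree]

@[simp]
theorem antipodeLin_D (i : B) : antipodeLin M (D M i) = -(s M i * D M i) := by
  simp [antipodeLin, antipodeHom, D, s, antipodeFree]

theorem mul_antipodeLin_rTensor_comulHom_mul (x : Alg M) (z : Alg M ⊗[ℤ] Alg M) :
    LinearMap.mul' ℤ (Alg M) (LinearMap.rTensor (Alg M) (antipodeLin M) (comulHom M x * z)) =
      counitHom M x • LinearMap.mul' ℤ (Alg M) (LinearMap.rTensor (Alg M) (antipodeLin M) z) := by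
  induction x using Alg.induction generalizing z with
  | hsM i =>
    induction z with
    | zero => simp
    | add z w hz hw => rw [mul_add, map_add, map_add, hz, hw, map_add, map_add, smul_add]
    | tmul a b => simp [antipodeLin_mul, mul_assoc, s_mul_s_mul]
  | hDM i =>
    induction z with
    | zero => simp
    | add z w hz hw => rw [mul_add, map_add, map_add, hz, hw, map_add, map_add, smul_add]
    | tmul a b => simp [add_mul, antipodeLin_mul, mul_assoc]
  | hz n =>
    rw [AlgHom.commutes, AlgHom.commutes, ← Algebra.smul_def, map_smul, map_smul,
      Algebra.algebraMap_self_apply]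
  | hadd x y hx hy => rw [map_add, add_mul, map_add, map_add, hx, hy, map_add, add_smul]
  | hmul x y hx hy => rw [map_mul (comulHom M), mul_assoc, hx, hy, map_mul, mul_smul]

theorem mul_antipodeLin_lTensor_mul_comulHom (x : Alg M) (z : Alg M ⊗[ℤ] Alg M) :
    LinearMap.mul' ℤ (Alg M) (LinearMap.lTensor (Alg M) (antipodeLin M) (z * comulHom M x)) =
      counitHom M x • LinearMap.mul' ℤ (Alg M) (LinearMap.lTensor (Alg M) (antipodeLin M) z) := by
  induction x using Alg.induction generalizing z with
  | hsM i =>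
    induction z with
    | zero => simp
    | add z w hz hw => rw [add_mul, map_add, map_add, hz, hw, map_add, map_add, smul_add]
    | tmul a b => simp [antipodeLin_mul, mul_assoc, s_mul_s_mul]
  | hDM i =>
    induction z with
    | zero => simp
    | add z w hz hw => rw [add_mul, map_add, map_add, hz, hw, map_add, map_add, smul_add]
    | tmul a b => simp [mul_add, antipodeLin_mul, mul_assoc, s_mul_s_mul]
  | hz n =>
    rw [AlgHom.commutes, AlgHom.commutes, ← Algebra.commutes, ← Algebra.smul_def, map_smul,
      map_smul, Algebra.algebraMap_self_apply]
  | hadd x y hx hy => rw [map_add, mul_add, map_add, map_add, hx, hy, map_add, add_smul]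
  | hmul x y hx hy => rw [map_mul (comulHom M), ← mul_assoc, hy, hx, map_mul, mul_comm, mul_smul]

theorem comulHom_coassoc :
    ((Algebra.TensorProduct.assoc ℤ ℤ ℤ (Alg M) (Alg M) (Alg M)).toAlgHom.comp
      (Algebra.TensorProduct.map (comulHom M) (AlgHom.id ℤ (Alg M)))).comp (comulHom M) =
      (Algebra.TensorProduct.map (AlgHom.id ℤ (Alg M)) (comulHom M)).comp (comulHom M) := by
  apply Alg.algHom_ext <;> intro i
  · simp
  · simp [TensorProduct.add_tmul, TensorProduct.tmul_add, Algebra.TensorProduct.one_def, add_assoc]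

theorem comulHom_rTensor_counitHom :
    ((Algebra.TensorProduct.lid ℤ (Alg M)).toAlgHom.comp
      (Algebra.TensorProduct.map (counitHom M) (AlgHom.id ℤ (Alg M)))).comp (comulHom M) =
      AlgHom.id ℤ (Alg M) := by
  apply Alg.algHom_ext <;> intro i <;> simp

theorem comulHom_lTensor_counitHom :
    ((Algebra.TensorProduct.rid ℤ ℤ (Alg M)).toAlgHom.comp
      (Algebra.TensorProduct.map (AlgHom.id ℤ (Alg M)) (counitHom M))).comp (comulHom M) =
      AlgHom.id ℤ (Alg M) := by
  apply Alg.algHom_ext <;> intro i <;> simp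

/-- The Hopf algebra structure of `Ĥ(W)`. -/
noncomputable def hopfAlgStruct : HopfAlgStruct ℤ (Alg M) where
  comul := comulHom M
  counit := counitHom M
  antipode := antipodeLin M
  antipode_one := antipodeLin_one M
  antipode_mul := antipodeLin_mul M
  coassoc x := DFunLike.congr_fun (comulHom_coassoc M) x
  counit_comul x := DFunLike.congr_fun (comulHom_rTensor_counitHom M) x
  comul_counit x := DFunLike.congr_fun (comulHom_lTensor_counitHom M) x
  mul_antipode_rTensor_comul x := by
    have h := mul_antipodeLin_rTensor_comulHom_mul M x 1
    rwa [mul_one, Algebra.TensorProduct.one_def, LinearMap.rTensor_tmul, antipodeLin_one,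
      LinearMap.mul'_apply, mul_one, ← Algebra.algebraMap_eq_smul_one] at h
  mul_antipode_lTensor_comul x := by
    have h := mul_antipodeLin_lTensor_mul_comulHom M x 1
    rwa [one_mul, Algebra.TensorProduct.one_def, LinearMap.lTensor_tmul, antipodeLin_one,
      LinearMap.mul'_apply, mul_one, ← Algebra.algebraMap_eq_smul_one] at h

end

/-- For every Coxeter group `W`, `Ĥ(W)` admits a Hopf algebra structure over
`ℤ` with `Δ(sᵢ) = sᵢ ⊗ sᵢ`, `Δ(Dᵢ) = Dᵢ ⊗ 1 + sᵢ ⊗ Dᵢ`, `ε(sᵢ) = 1`, `ε(Dᵢ) = 0`,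
`S(sᵢ) = sᵢ`, `S(Dᵢ) = -sᵢ·Dᵢ`. -/
theorem hopf_structure_on_HW {B : Type*} (M : CoxeterMatrix B) :
    ∃ H : HopfAlgStruct ℤ (HW M),
      (∀ i : B, H.comul (hs M i) = hs M i ⊗ₜ[ℤ] hs M i) ∧
      (∀ i : B, H.comul (hD M i) = hD M i ⊗ₜ[ℤ] 1 + hs M i ⊗ₜ[ℤ] hD M i) ∧
      (∀ i : B, H.counit (hs M i) = 1) ∧
      (∀ i : B, H.counit (hD M i) = 0) ∧
      (∀ i : B, H.antipode (hs M i) = hs M i) ∧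
      (∀ i : B, H.antipode (hD M i) = -(hs M i * hD M i)) := by
  exact ⟨hopfAlgStruct M, comulHom_s M, comulHom_D M, counitHom_s M, counitHom_D M,
    antipodeLin_s M, antipodeLin_D M⟩

end HeckeHopfCox
end

section
/- For every Coxeter group W there exists a unique family (D_s)_{s ∈ 𝒮} of elements of Ĥ(W), indexed by the set 𝒮 of reflections of W, such that D_{s_i} equals the generator D_i for every i ∈ I, and s_i·D_s·s_i = D_{s_i s s_i} in Ĥ(W) for every i ∈ I and every reflection s ∈ 𝒮 with s ≠ s_i. -/
open scoped TensorProduct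

namespace HeckeHopfCox

section Geometric

open Real

variable {B : Type*} (M : CoxeterMatrix B)

/-- The simple coroot attached to `i`, as a function on the simple roots. When `M i j = 0` the
division by zero gives the entry `-2` appropriate for `m = ∞`. -/
noncomputable def coroot (i j : B) : ℝ := -2 * cos (π / M i j)

lemma coroot_self (i : B) : coroot M i i = 2 := by simp [coroot]

lemma coroot_comm (i j : B) : coroot M i j = coroot M j i := by
  rw [coroot, coroot, M.symmetric]

/-- The simple reflection of the contragredient geometric representation. -/
noncomputable def geomRefl (i : B) : Module.End ℝ (B → ℝ) :=
  LinearMap.id - (LinearMap.proj i).smulRight (coroot M i)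

lemma geomRefl_apply (i : B) (f : B → ℝ) : geomRefl M i f = f - f i • coroot M i := by
  simp [geomRefl]

lemma geomRefl_mul_self (i : B) : geomRefl M i * geomRefl M i = 1 := by
  refine LinearMap.ext fun f => funext fun j => ?_
  simp only [Module.End.mul_apply, geomRefl_apply, Module.End.one_apply, Pi.sub_apply,
    Pi.smul_apply, smul_eq_mul, coroot_self]
  ring

/-- The complex linear form diagonalizing the product of two simple reflections. -/
noncomputable def rotForm (i j : B) (f : B → ℝ) : ℂ :=
  f j + Complex.exp (-(π / M i j * Complex.I)) * f i

lemma rotForm_mul (i j : B) (f : B → ℝ) :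
    rotForm M i j ((geomRefl M i * geomRefl M j) f) =
      Complex.exp (2 * π * Complex.I / M i j) * rotForm M i j f := by
  have hc : ((2 * cos (π / M i j) : ℝ) : ℂ) =
      Complex.exp (π / M i j * Complex.I) + Complex.exp (-(π / M i j * Complex.I)) := by
    push_cast [Complex.cos]
    rw [neg_mul]
    ring
  have h1 : Complex.exp (π / M i j * Complex.I) * Complex.exp (-(π / M i j * Complex.I)) = 1 := by
    rw [← Complex.exp_add]; simp
  have h2 : Complex.exp (2 * π * Complex.I / M i j) = Complex.exp (π / M i j * Complex.I) ^ 2 := by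
    rw [← Complex.exp_nat_mul]; congr 1; push_cast; ring
  have hji : coroot M j i = -(2 * cos (π / M i j)) := by rw [coroot_comm, coroot]; ring
  have hij : coroot M i j = -(2 * cos (π / M i j)) := by rw [coroot]; ring
  simp only [rotForm, Module.End.mul_apply, geomRefl_apply, Pi.sub_apply, Pi.smul_apply,
    smul_eq_mul, coroot_self, hij, hji, h2, Complex.ofReal_sub, Complex.ofReal_mul,
    Complex.ofReal_neg] at hc ⊢
  rw [hc]
  generalize Complex.exp (π / M i j * Complex.I) = e at *
  generalize Complex.exp (-(π / M i j * Complex.I)) = e' at *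
  push_cast
  linear_combination (f j - e * f i) * h1

lemma rotForm_pow (i j : B) (f : B → ℝ) (q : ℕ) :
    rotForm M i j (((geomRefl M i * geomRefl M j) ^ q) f) =
      Complex.exp (2 * π * Complex.I / M i j) ^ q * rotForm M i j f := by
  induction q with
  | zero => simp
  | succ q ih => rw [pow_succ', Module.End.mul_apply, rotForm_mul, ih]; ring

lemma exists_geomRefl_mul_pow_apply (i j : B) (f : B → ℝ) (q : ℕ) :
    ∃ x y : ℝ, ((geomRefl M i * geomRefl M j) ^ q) f = f + x • coroot M i + y • coroot M j := by
  induction q with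
  | zero => exact ⟨0, 0, by simp⟩
  | succ q ih =>
    obtain ⟨x, y, h⟩ := ih
    rw [pow_succ', Module.End.mul_apply, h, Module.End.mul_apply, geomRefl_apply, geomRefl_apply]
    generalize (f + x • coroot M i + y • coroot M j) j = a
    generalize (f + x • coroot M i + y • coroot M j - a • coroot M j) i = b
    exact ⟨x - b, y - a, by module⟩

lemma isLiftable_geomRefl : M.IsLiftable (geomRefl M) := by
  intro i j
  rcases eq_or_ne i j with rfl | hij
  · rw [M.diagonal, pow_one, geomRefl_mul_self]
  rcases eq_or_ne (M i j) 0 with h0 | h0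
  · rw [h0, pow_zero]
  have hm : 1 < M i j := by have := M.off_diagonal i j hij; omega
  have hmR : (1 : ℝ) < M i j := by exact_mod_cast hm
  refine LinearMap.ext fun f => ?_
  obtain ⟨x, y, h⟩ := exists_geomRefl_mul_pow_apply M i j f (M i j)
  have hL := rotForm_pow M i j f (M i j)
  rw [(Complex.isPrimitiveRoot_exp _ h0).pow_eq_one, one_mul, h] at hL
  have hsin : sin (π / M i j) ≠ 0 :=
    (sin_pos_of_pos_of_lt_pi (by positivity) (div_lt_self pi_pos hmR)).ne'
  have hexp : Complex.exp (-(π / M i j * Complex.I)) =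
      (cos (π / M i j) : ℂ) - (sin (π / M i j) : ℂ) * Complex.I := by
    rw [← neg_mul, Complex.exp_mul_I, Complex.cos_neg, Complex.sin_neg]
    push_cast
    ring
  have hji : coroot M j i = -(2 * cos (π / M i j)) := by rw [coroot_comm, coroot]; ring
  have hij' : coroot M i j = -(2 * cos (π / M i j)) := by rw [coroot]; ring
  have hsc := sin_sq_add_cos_sq (π / M i j)
  rw [rotForm, rotForm, hexp] at hL
  have hre := congrArg Complex.re hL
  have him := congrArg Complex.im hL
  simp only [Pi.add_apply, Pi.smul_apply, smul_eq_mul, coroot_self, hji, hij',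
    Complex.add_re, Complex.add_im, Complex.mul_re, Complex.mul_im, Complex.sub_re, Complex.sub_im,
    Complex.ofReal_re, Complex.ofReal_im, Complex.I_re, Complex.I_im] at hre him
  generalize cos (π / M i j) = c at *
  generalize sin (π / M i j) = s at *
  have e1 : x - c * y = 0 := by
    have : s * (x - c * y) = 0 := by linear_combination -him / 2
    exact (mul_eq_zero.mp this).resolve_left hsin
  have e2 : y - c * x = 0 := by linear_combination hre / 2 - c * e1
  have hx : x = 0 := by
    have : s ^ 2 * x = 0 := by linear_combination e1 + c * e2 + x * hsc
    exact (mul_eq_zero.mp this).resolve_left (pow_ne_zero 2 hsin)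
  have hy : y = 0 := by linear_combination e2 + c * hx
  simp [h, hx, hy]

/-- The geometric representation shows that the order of `s i * s j` is a multiple of `M i j`. -/
lemma dvd_of_simple_mul_simple_pow_eq_one {W : Type*} [Group W] (cs : CoxeterSystem M W) {i j : B}
    {q : ℕ} (h : (cs.simple i * cs.simple j) ^ q = 1) : M i j ∣ q := by
  classical
  have hg : (geomRefl M i * geomRefl M j) ^ q = 1 := by
    simpa using congrArg (cs.lift ⟨geomRefl M, isLiftable_geomRefl M⟩) h
  rcases eq_or_ne i j with rfl | hij
  · simp
  rcases eq_or_ne (M i j) 0 with h0 | h0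
  · have key : ∀ (f : B → ℝ), f i + f j = 1 → ∀ n : ℕ,
        (((geomRefl M i * geomRefl M j) ^ n) f) i = f i - 2 * n ∧
        (((geomRefl M i * geomRefl M j) ^ n) f) j = f j + 2 * n := by
      intro f hf n
      have hij' : coroot M i j = -2 := by simp [coroot, h0]
      have hji : coroot M j i = -2 := by rw [coroot_comm, hij']
      induction n with
      | zero => simp
      | succ n ih =>
        rw [pow_succ', Module.End.mul_apply]
        generalize ((geomRefl M i * geomRefl M j) ^ n) f = f' at ih ⊢
        simp only [Module.End.mul_apply, geomRefl_apply, Pi.sub_apply, Pi.smul_apply, smul_eq_mul,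
          coroot_self, hij', hji, ih.1, ih.2]
        push_cast
        exact ⟨by linear_combination -2 * hf, by linear_combination 2 * hf⟩
    have := (key (Pi.single j 1) (by simp [hij]) q).1
    simp [hg, hij] at this
    simp [h0, this]
  · have := rotForm_pow M i j (Pi.single j 1) q
    rw [hg] at this
    have h1 : rotForm M i j (Pi.single j 1) ≠ 0 := by simp [rotForm, hij]
    exact (Complex.isPrimitiveRoot_exp _ h0).dvd_of_pow_eq_one _
      (mul_right_cancel₀ h1 (by rw [← this, one_mul, Module.End.one_apply]))

end Geometric
section Exchange

variable {B W : Type*} [Group W] {M : CoxeterMatrix B} (cs : CoxeterSystem M W)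

open Classical in
/-- The action of a simple reflection on signed reflections. -/
noncomputable def signStep (i : B) : Function.End (W × ZMod 2) := fun p =>
  (cs.simple i * p.1 * cs.simple i, p.2 + if p.1 = cs.simple i then 1 else 0)

open Classical in
lemma signStep_mul_pow_apply (i j : B) (t : W) (e : ZMod 2) (k : ℕ) :
    ((signStep cs i * signStep cs j) ^ k) (t, e) =
      ((cs.simple i * cs.simple j) ^ k * t * ((cs.simple i * cs.simple j) ^ k)⁻¹,
        e + ∑ q ∈ Finset.range (2 * k),
          if t = (cs.simple j * cs.simple i) ^ q * cs.simple j then 1 else 0) := by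
  induction k with
  | zero => simp; rfl
  | succ k ih =>
    have hinv : cs.simple j * cs.simple i = (cs.simple i * cs.simple j)⁻¹ := by simp
    have hconj : cs.simple j * (cs.simple i * cs.simple j) ^ k =
        ((cs.simple i * cs.simple j) ^ k)⁻¹ * cs.simple j := by
      rw [← inv_pow, ← hinv]
      exact (SemiconjBy.pow_right (show SemiconjBy _ _ _ by simp [SemiconjBy, mul_assoc]) k).eq
    have h1 : (cs.simple i * cs.simple j) ^ k * t * ((cs.simple i * cs.simple j) ^ k)⁻¹
        = cs.simple j ↔ t = (cs.simple j * cs.simple i) ^ (2 * k) * cs.simple j := by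
      rw [mul_inv_eq_iff_eq_mul, hconj, hinv, inv_pow, two_mul, pow_add,
        ← eq_inv_mul_iff_mul_eq, mul_inv_rev, mul_assoc]
    have h2 : cs.simple j * ((cs.simple i * cs.simple j) ^ k * t *
        ((cs.simple i * cs.simple j) ^ k)⁻¹) * cs.simple j = cs.simple i ↔
          t = (cs.simple j * cs.simple i) ^ (2 * k + 1) * cs.simple j := by
      have hA : (cs.simple j * cs.simple i) ^ (2 * k + 1) * cs.simple j =
          ((cs.simple i * cs.simple j) ^ k)⁻¹ * (cs.simple j * cs.simple i * cs.simple j) *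
            (cs.simple i * cs.simple j) ^ k := by
        rw [mul_assoc (_⁻¹), mul_assoc _ (cs.simple j), hconj, ← inv_pow, ← hinv,
          show 2 * k + 1 = k + 1 + k by omega, pow_add, pow_succ]
        simp only [mul_assoc]
      rw [hA]
      generalize (cs.simple i * cs.simple j) ^ k = a
      constructor
      · intro h
        rw [← h]
        simp [mul_assoc]
      · rintro rfl
        simp [mul_assoc]
    rw [pow_succ', show 2 * (k + 1) = 2 * k + 1 + 1 from rfl, Finset.sum_range_succ,
      Finset.sum_range_succ]
    change signStep cs i (signStep cs j (((signStep cs i * signStep cs j) ^ k) (t, e))) = _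
    rw [ih]
    simp only [signStep, h1, h2, Prod.mk.injEq]
    constructor
    · simp [pow_succ', mul_assoc]
    · abel

lemma isLiftable_signStep : M.IsLiftable (signStep cs) := by
  classical
  intro i j
  funext p
  obtain ⟨t, e⟩ := p
  rw [signStep_mul_pow_apply, two_mul, Finset.sum_range_add, cs.simple_mul_simple_pow]
  simp only [pow_add, cs.simple_mul_simple_pow', one_mul, CharTwo.add_self_eq_zero]
  simp
  rfl

/-- The action of a Coxeter group on signed reflections. -/
noncomputable def signAct : W →* Function.End (W × ZMod 2) :=
  cs.lift ⟨signStep cs, isLiftable_signStep cs⟩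

lemma signAct_simple (i : B) : signAct cs (cs.simple i) = signStep cs i :=
  cs.lift_apply_simple _ i

lemma signAct_mul (v w : W) (p : W × ZMod 2) :
    signAct cs (v * w) p = signAct cs v (signAct cs w p) := by
  rw [map_mul]; rfl

lemma signAct_one (p : W × ZMod 2) : signAct cs 1 p = p := by
  rw [map_one]; rfl

lemma signAct_fst (w : W) (p : W × ZMod 2) : (signAct cs w p).1 = w * p.1 * w⁻¹ := by
  induction w using cs.simple_induction_left with
  | one => simp [signAct_one]
  | mul_simple_left w i ih =>
    rw [signAct_mul, signAct_simple, signStep, ih]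
    simp [mul_assoc]

lemma signAct_add (w t : W) (e d : ZMod 2) :
    signAct cs w (t, e + d) = ((signAct cs w (t, e)).1, (signAct cs w (t, e)).2 + d) := by
  induction w using cs.simple_induction_left with
  | one => simp [signAct_one]
  | mul_simple_left w i ih =>
    rw [signAct_mul, ih, signAct_mul, signAct_simple]
    simp only [signStep, Prod.mk.injEq, true_and]
    abel

lemma mem_rightInvSeq_of_signAct_ne_zero (ω : List B) (t : W)
    (h : (signAct cs (cs.wordProd ω) (t, 0)).2 ≠ 0) : t ∈ cs.rightInvSeq ω := by
  induction ω with
  | nil => simp [signAct_one] at h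
  | cons i ω ih =>
    rw [CoxeterSystem.rightInvSeq, List.mem_cons]
    by_contra! hn
    apply h
    rw [cs.wordProd_cons, signAct_mul, signAct_simple, signStep, signAct_fst]
    have h0 : (signAct cs (cs.wordProd ω) (t, 0)).2 = 0 := by
      by_contra h'
      exact hn.2 (ih h')
    rw [h0, zero_add, if_neg]
    rw [mul_inv_eq_iff_eq_mul]
    intro h'
    exact hn.1 (by rw [mul_assoc, ← h', inv_mul_cancel_left])

lemma signAct_simple_self (i : B) (e : ZMod 2) :
    signAct cs (cs.simple i) (cs.simple i, e) = (cs.simple i, e + 1) := by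
  simp [signAct_simple, signStep]

lemma signAct_ne_zero_of_isRightDescent {w : W} {i : B} (h : cs.IsRightDescent w i) :
    (signAct cs w (cs.simple i, 0)).2 ≠ 0 := by
  intro h0
  obtain ⟨ω, hω, hw⟩ := cs.exists_isReduced (w * cs.simple i)
  have h1 : (signAct cs (cs.wordProd ω) (cs.simple i, 0)).2 ≠ 0 := by
    rw [← hw, signAct_mul, signAct_simple_self, signAct_add, h0]
    exact one_ne_zero
  have h2 := (cs.isRightInversion_of_mem_rightInvSeq hω
    (mem_rightInvSeq_of_signAct_ne_zero cs ω _ h1)).2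
  rw [← hw, cs.simple_mul_simple_cancel_right] at h2
  exact lt_asymm h h2

/-- The exchange property. -/
lemma simple_mem_leftInvSeq {ω : List B} {i : B} (h : cs.IsLeftDescent (cs.wordProd ω) i) :
    cs.simple i ∈ cs.leftInvSeq ω := by
  have h' : cs.IsRightDescent (cs.wordProd ω.reverse) i := by
    rwa [cs.wordProd_reverse, cs.isRightDescent_inv_iff]
  have := mem_rightInvSeq_of_signAct_ne_zero cs _ _ (signAct_ne_zero_of_isRightDescent cs h')
  rwa [cs.rightInvSeq_reverse, List.mem_reverse] at this

/-- The alternating word `i, j, i, …` of length `n`, starting with `i`. -/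
def altWord : B → B → ℕ → List B
  | _, _, 0 => []
  | i, j, n + 1 => i :: altWord j i n

lemma length_altWord (i j : B) (n : ℕ) : (altWord i j n).length = n := by
  induction n generalizing i j with
  | zero => rfl
  | succ n ih => simp [altWord, ih]

lemma exists_of_mem_leftInvSeq_altWord {i j : B} {n : ℕ} {t : W}
    (h : t ∈ cs.leftInvSeq (altWord i j n)) :
    ∃ p < n, t = (cs.simple i * cs.simple j) ^ p * cs.simple i := by
  induction n generalizing i j t with
  | zero => simp [altWord] at h
  | succ n ih =>
    rw [altWord, CoxeterSystem.leftInvSeq, List.mem_cons, List.mem_map] at h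
    rcases h with rfl | ⟨t', ht', rfl⟩
    · exact ⟨0, by simp⟩
    · obtain ⟨p, hp, rfl⟩ := ih ht'
      refine ⟨p + 1, by omega, ?_⟩
      have := (SemiconjBy.pow_right (show SemiconjBy (cs.simple i) (cs.simple j * cs.simple i)
        (cs.simple i * cs.simple j) by simp [SemiconjBy, mul_assoc]) p).eq
      rw [MulAut.conj_apply, cs.inv_simple, ← mul_assoc, this, pow_succ]
      simp only [mul_assoc]

lemma mem_leftInvSeq_append {ω η : List B} {t : W} (h : t ∈ cs.leftInvSeq (ω ++ η)) :
    t ∈ cs.leftInvSeq ω ∨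
      ∃ t' ∈ cs.leftInvSeq η, t = cs.wordProd ω * t' * (cs.wordProd ω)⁻¹ := by
  induction ω generalizing t with
  | nil => exact Or.inr ⟨t, h, by simp⟩
  | cons i ω ih =>
    rw [List.cons_append, CoxeterSystem.leftInvSeq, List.mem_cons, List.mem_map] at h
    rcases h with rfl | ⟨t', ht', rfl⟩
    · simp [CoxeterSystem.leftInvSeq]
    · rcases ih ht' with h | ⟨t'', h, rfl⟩
      · exact Or.inl (List.mem_cons_of_mem _ (List.mem_map_of_mem h))
      · exact Or.inr ⟨t'', h, by simp [cs.wordProd_cons, mul_assoc]⟩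

/-- An element with two left descents `i`, `j` starts with an alternating word in `i`, `j` of any
length up to `M i j`. -/
lemma exists_eq_altWord_mul {z : W} {i j : B} (hi : cs.IsLeftDescent z i)
    (hj : cs.IsLeftDescent z j) (hij : i ≠ j) (n : ℕ) (hn : M i j = 0 ∨ n ≤ M i j) :
    ∃ x, z = cs.wordProd (altWord i j n) * x ∧ cs.length z = n + cs.length x := by
  induction n generalizing i j with
  | zero => exact ⟨z, by simp [altWord]⟩
  | succ n ih =>
    obtain ⟨x, hz, hl⟩ := ih hj hi hij.symm (by rw [M.symmetric]; omega)
    obtain ⟨η, hη, hx⟩ := cs.exists_isReduced x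
    have hd := hi
    rw [hz, hx, ← cs.wordProd_append] at hd
    rcases mem_leftInvSeq_append cs (simple_mem_leftInvSeq cs hd) with h | ⟨t, ht, h⟩
    · obtain ⟨p, hp, h⟩ := exists_of_mem_leftInvSeq_altWord cs h
      have h1 : (cs.simple j * cs.simple i) ^ (p + 1) = 1 := by
        rw [pow_succ, ← mul_assoc, ← h, cs.simple_mul_simple_self]
      have h2 := dvd_of_simple_mul_simple_pow_eq_one M cs h1
      rw [M.symmetric] at h2
      rcases hn with hn | hn
      · simp [hn] at h2
      · have := Nat.le_of_dvd (by omega) h2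
        omega
    · have hlt := (cs.isLeftInversion_of_mem_leftInvSeq hη ht).2
      rw [← hx] at hlt
      have hz' : z = cs.wordProd (altWord i j (n + 1)) * (t * x) := by
        have htt := (cs.isReflection_of_mem_leftInvSeq η ht).mul_self
        rw [altWord, cs.wordProd_cons, h, hz, inv_mul_cancel_right, mul_assoc, ← mul_assoc t, htt,
          one_mul]
      have h3 := cs.length_mul_le (cs.wordProd (altWord i j (n + 1))) (t * x)
      have h4 := cs.length_wordProd_le (altWord i j (n + 1))
      rw [length_altWord] at h4
      rw [← hz'] at h3
      exact ⟨t * x, hz', by omega⟩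

lemma ne_zero_of_isLeftDescent {z : W} {i j : B} (hi : cs.IsLeftDescent z i)
    (hj : cs.IsLeftDescent z j) (hij : i ≠ j) : M i j ≠ 0 := by
  intro h0
  obtain ⟨x, -, h⟩ := exists_eq_altWord_mul cs hi hj hij (cs.length z + 1) (Or.inl h0)
  omega

lemma simple_injective : Function.Injective cs.simple := by
  intro i j h
  by_contra hij
  have := dvd_of_simple_mul_simple_pow_eq_one M cs (i := i) (j := j) (q := 1) (by simp [h])
  exact M.off_diagonal i j hij (Nat.dvd_one.mp this)

end Exchange
section Braid

variable {B W : Type*} [Group W] {M : CoxeterMatrix B} (cs : CoxeterSystem M W)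

lemma altWord_succ' (i j : B) (n : ℕ) :
    altWord i j (n + 1) = altWord i j n ++ [if Even n then i else j] := by
  induction n generalizing i j with
  | zero => simp [altWord]
  | succ n ih =>
    rw [altWord, ih, altWord, List.cons_append]
    by_cases h : Even n <;> simp [h, Nat.even_add_one]

lemma altWord_eq_alternatingWord (i j : B) (n : ℕ) :
    altWord i j n = if Even n then CoxeterSystem.alternatingWord i j n
      else CoxeterSystem.alternatingWord j i n := by
  induction n generalizing i j with
  | zero => simp [altWord, CoxeterSystem.alternatingWord]
  | succ n ih =>
    rw [altWord, ih, CoxeterSystem.alternatingWord_succ', CoxeterSystem.alternatingWord_succ']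
    by_cases h : Even n <;> simp [h, Nat.even_add_one]

lemma wordProd_altWord_comm (i j : B) :
    cs.wordProd (altWord i j (M i j)) = cs.wordProd (altWord j i (M i j)) := by
  have h := cs.wordProd_braidWord_eq i j
  rw [CoxeterSystem.braidWord, CoxeterSystem.braidWord, M.symmetric j i] at h
  rw [altWord_eq_alternatingWord, altWord_eq_alternatingWord]
  split_ifs
  · exact h
  · exact h.symm

/-- The linear braid relation at the level of simple reflections. -/
lemma simple_mul_wordProd_altWord (i j : B) (h0 : M i j ≠ 0) :
    cs.simple i * cs.wordProd (altWord j i (M i j - 1)) =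
      cs.wordProd (altWord j i (M i j - 1)) *
        cs.simple (if M i j % 2 = 0 then i else j) := by
  obtain ⟨n, hn⟩ := Nat.exists_eq_succ_of_ne_zero h0
  have h := wordProd_altWord_comm cs i j
  rw [hn, Nat.succ_eq_add_one, altWord_succ' j i, altWord, cs.wordProd_cons, cs.wordProd_append,
    cs.wordProd_singleton] at h
  rw [hn, Nat.succ_eq_add_one, Nat.add_sub_cancel, h]
  congr 2
  by_cases he : Even n
  · rw [if_pos he, if_neg (by have := Nat.even_iff.mp he; omega)]
  · rw [if_neg he, if_pos (by have := Nat.not_even_iff.mp he; omega)]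

end Braid

section HeckeHopf

variable {B : Type*} (M : CoxeterMatrix B)

lemma isLiftable_hs : M.IsLiftable (hs M) := fun i j => by
  simpa [hs] using RingQuot.mkAlgHom_rel ℤ (Rel.coxeter (M := M) i j)

/-- The canonical homomorphism from the Coxeter group to `Ĥ(W)`. -/
noncomputable def groupHom : M.Group →* HW M :=
  M.toCoxeterSystem.lift ⟨hs M, isLiftable_hs M⟩

lemma groupHom_simple (i : B) : groupHom M (M.toCoxeterSystem.simple i) = hs M i :=
  M.toCoxeterSystem.lift_apply_simple _ i

lemma groupHom_mul_groupHom_inv (w : M.Group) : groupHom M w * groupHom M w⁻¹ = 1 := by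
  rw [← map_mul, mul_inv_cancel, map_one]

lemma mkAlgHom_altS (i j : B) (n : ℕ) :
    RingQuot.mkAlgHom ℤ (Rel M) (altS i j n) =
      groupHom M (M.toCoxeterSystem.wordProd (altWord i j n)) := by
  induction n generalizing i j with
  | zero => simp [altS, altWord]
  | succ n ih =>
    rw [altS, altWord, map_mul, ih, CoxeterSystem.wordProd_cons, map_mul, groupHom_simple, hs]

lemma hD_mul_altWord {i j : B} (hij : i ≠ j) (h0 : M i j ≠ 0) :
    hD M i * groupHom M (M.toCoxeterSystem.wordProd (altWord j i (M i j - 1))) =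
      groupHom M (M.toCoxeterSystem.wordProd (altWord j i (M i j - 1))) *
        hD M (if M i j % 2 = 0 then i else j) := by
  have h := RingQuot.mkAlgHom_rel ℤ (Rel.braidLin (M := M) i j hij h0)
  rwa [map_mul, map_mul, mkAlgHom_altS] at h

/-- If `w` carries the positive simple root `j` to the positive simple root `i`, then conjugation
by `w` carries `D j` to `D i`. -/
lemma hD_mul_groupHom {w : M.Group} {i j : B}
    (h : M.toCoxeterSystem.simple i * w = w * M.toCoxeterSystem.simple j)
    (hl : ¬ M.toCoxeterSystem.IsLeftDescent w i) :
    hD M i * groupHom M w = groupHom M w * hD M j := by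
  induction hn : M.toCoxeterSystem.length w using Nat.strong_induction_on generalizing w i j with
  | _ n ih =>
  set cs := M.toCoxeterSystem with hcs
  rcases eq_or_ne w 1 with rfl | hw
  · rw [mul_one, one_mul] at h
    rw [simple_injective cs h, map_one, mul_one, one_mul]
  obtain ⟨k, hk⟩ := cs.exists_leftDescent_of_ne_one hw
  have hik : i ≠ k := by rintro rfl; exact hl hk
  have hz : cs.length (cs.simple i * w) = cs.length w + 1 := cs.not_isLeftDescent_iff.mp hl
  have hdi : cs.IsLeftDescent (cs.simple i * w) i := by
    rw [CoxeterSystem.IsLeftDescent, cs.simple_mul_simple_cancel_left]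
    omega
  have hdk : cs.IsLeftDescent (cs.simple i * w) k := by
    have h1 := cs.length_mul_le (cs.simple k * w) (cs.simple j)
    rw [cs.length_simple, mul_assoc, ← h] at h1
    rw [CoxeterSystem.IsLeftDescent] at hk ⊢
    omega
  have h0 := ne_zero_of_isLeftDescent cs hdi hdk hik
  have h1 := M.off_diagonal i k hik
  obtain ⟨x, hx, hlx⟩ := exists_eq_altWord_mul cs hdi hdk hik (M i k) (Or.inr le_rfl)
  have hbraid := simple_mul_wordProd_altWord cs i k h0
  have hD := hD_mul_altWord M hik h0
  rw [← hcs] at hD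
  have hlu := cs.length_wordProd_le (altWord k i (M i k - 1))
  rw [length_altWord] at hlu
  have hwx : w = cs.wordProd (altWord k i (M i k - 1)) * x := by
    obtain ⟨n, hn⟩ := Nat.exists_eq_succ_of_ne_zero h0
    rw [hn, Nat.succ_eq_add_one, altWord, cs.wordProd_cons, mul_assoc] at hx
    rw [hn, Nat.succ_eq_add_one, Nat.add_sub_cancel]
    exact mul_left_cancel hx
  generalize cs.wordProd (altWord k i (M i k - 1)) = u at *
  generalize (if M i k % 2 = 0 then i else k) = i' at *
  have hx' : cs.simple i' * x = x * cs.simple j := by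
    apply mul_left_cancel (a := u)
    rw [← mul_assoc, ← hbraid, mul_assoc, ← hwx, h, hwx, mul_assoc]
  have hlx' : ¬ cs.IsLeftDescent x i' := by
    have h2 := cs.length_mul_le u (cs.simple i' * x)
    rw [← mul_assoc, ← hbraid, mul_assoc, ← hwx] at h2
    rw [CoxeterSystem.IsLeftDescent]
    omega
  have := ih (cs.length x) (by omega) hx' hlx' rfl
  rw [hwx, map_mul, ← mul_assoc, hD, mul_assoc, this, mul_assoc]

/-- The conjugate of `D i` by `w` only depends on the signed reflection `w • (s i, +)`. -/
lemma conj_hD_eq {v w : M.Group} {i j : B}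
    (h : signAct M.toCoxeterSystem v (M.toCoxeterSystem.simple i, 0) =
      signAct M.toCoxeterSystem w (M.toCoxeterSystem.simple j, 0)) :
    groupHom M v * hD M i * groupHom M v⁻¹ = groupHom M w * hD M j * groupHom M w⁻¹ := by
  set cs := M.toCoxeterSystem with hcs
  have h1 : signAct cs (w⁻¹ * v) (cs.simple i, 0) = (cs.simple j, 0) := by
    rw [signAct_mul, h, ← signAct_mul, inv_mul_cancel, signAct_one]
  have h2 := signAct_fst cs (w⁻¹ * v) (cs.simple i, 0)
  rw [h1] at h2
  have h3 : ¬ cs.IsRightDescent (w⁻¹ * v) i := fun hd =>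
    signAct_ne_zero_of_isRightDescent cs hd (by rw [h1])
  have h4 := hD_mul_groupHom M (w := (w⁻¹ * v)⁻¹) (i := i) (j := j)
    (by rw [← hcs]; simp only at h2; rw [h2]; group) (by rwa [← hcs, cs.isLeftDescent_inv_iff])
  rw [mul_inv_rev, inv_inv, map_mul] at h4
  calc groupHom M v * hD M i * groupHom M v⁻¹
      = groupHom M v * (hD M i * (groupHom M v⁻¹ * groupHom M w)) * groupHom M w⁻¹ := by
        simp only [mul_assoc, groupHom_mul_groupHom_inv, mul_one]
    _ = groupHom M v * groupHom M v⁻¹ * groupHom M w * hD M j * groupHom M w⁻¹ := by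
        rw [h4]; simp only [mul_assoc]
    _ = _ := by rw [groupHom_mul_groupHom_inv, one_mul]

/-- Every positive reflection is the image of a positive simple reflection. -/
lemma exists_signAct_eq {t : M.Group} (ht : M.toCoxeterSystem.IsReflection t) :
    ∃ p : M.Group × B,
      signAct M.toCoxeterSystem p.1 (M.toCoxeterSystem.simple p.2, 0) = (t, 0) := by
  obtain ⟨w, i, rfl⟩ := ht
  set cs := M.toCoxeterSystem
  have h1 := signAct_fst cs w (cs.simple i, 0)
  by_cases h : (signAct cs w (cs.simple i, 0)).2 = 0
  · exact ⟨(w, i), Prod.ext h1 h⟩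
  · refine ⟨(w * cs.simple i, i), ?_⟩
    rw [signAct_mul, signAct_simple_self, signAct_add]
    have hz : ∀ e : ZMod 2, e ≠ 0 → e + 1 = 0 := by decide
    exact Prod.ext h1 (hz _ h)

/-- The element `D_t` attached to a reflection `t`. -/
noncomputable def reflD (t : Refl M) : HW M :=
  groupHom M (exists_signAct_eq M t.2).choose.1 * hD M (exists_signAct_eq M t.2).choose.2 *
    groupHom M (exists_signAct_eq M t.2).choose.1⁻¹

lemma reflD_eq (t : Refl M) {w : M.Group} {i : B}
    (h : signAct M.toCoxeterSystem w (M.toCoxeterSystem.simple i, 0) = (t.1, 0)) :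
    reflD M t = groupHom M w * hD M i * groupHom M w⁻¹ :=
  conj_hD_eq M ((exists_signAct_eq M t.2).choose_spec.trans h.symm)

lemma reflD_simple (i : B) (h : M.toCoxeterSystem.IsReflection (M.toCoxeterSystem.simple i)) :
    reflD M ⟨M.toCoxeterSystem.simple i, h⟩ = hD M i := by
  rw [reflD_eq M _ (w := 1) (i := i) (signAct_one _ _)]
  simp

lemma hs_mul_reflD_mul_hs (i : B) (t : Refl M) (hti : (t : M.Group) ≠ M.toCoxeterSystem.simple i)
    (h : M.toCoxeterSystem.IsReflection
      (M.toCoxeterSystem.simple i * (t : M.Group) * M.toCoxeterSystem.simple i)) :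
    hs M i * reflD M t * hs M i =
      reflD M ⟨M.toCoxeterSystem.simple i * (t : M.Group) * M.toCoxeterSystem.simple i, h⟩ := by
  obtain ⟨⟨w, j⟩, hw⟩ := exists_signAct_eq M t.2
  rw [reflD_eq M t hw, reflD_eq M _ (w := M.toCoxeterSystem.simple i * w) (i := j)]
  · rw [map_mul, mul_inv_rev, map_mul, CoxeterSystem.inv_simple, groupHom_simple]
    simp only [mul_assoc]
  · simp only at hw
    rw [signAct_mul, hw, signAct_simple]
    simp only [signStep, if_neg hti, add_zero]

end HeckeHopf

/-- For every Coxeter group `W` there is a unique family `(D_s)_{s ∈ 𝒮}` of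
elements of `Ĥ(W)`, indexed by the reflections of `W`, with `D_{sᵢ} = Dᵢ` for every `i ∈ I`
and `sᵢ·D_s·sᵢ = D_{sᵢ s sᵢ}` for every `i ∈ I` and reflection `s ≠ sᵢ`. -/
theorem exists_unique_Ds {B : Type*} (M : CoxeterMatrix B) :
    ∃! Dfam : Refl M → HW M,
      (∀ (i : B) (h : M.toCoxeterSystem.IsReflection (M.toCoxeterSystem.simple i)),
        Dfam ⟨M.toCoxeterSystem.simple i, h⟩ = hD M i) ∧
      (∀ (i : B) (t : Refl M),
        (t : M.Group) ≠ M.toCoxeterSystem.simple i →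
        ∀ h : M.toCoxeterSystem.IsReflection
            (M.toCoxeterSystem.simple i * (t : M.Group) * M.toCoxeterSystem.simple i),
          hs M i * Dfam t * hs M i =
            Dfam ⟨M.toCoxeterSystem.simple i * (t : M.Group) * M.toCoxeterSystem.simple i, h⟩) := by
  refine ⟨reflD M, ⟨reflD_simple M, hs_mul_reflD_mul_hs M⟩, ?_⟩
  rintro g ⟨hg, hg'⟩
  have key : ∀ (w : M.Group) (i : B) (t : Refl M),
      t.1 = w * M.toCoxeterSystem.simple i * w⁻¹ → g t = reflD M t := by
    intro w i
    induction w using M.toCoxeterSystem.simple_induction_left with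
    | one =>
      rintro ⟨t, ht⟩ h
      rw [one_mul, inv_one, mul_one] at h
      subst h
      rw [hg, reflD_simple]
    | mul_simple_left w k ih =>
      rintro ⟨t, ht⟩ h
      have ht' : M.toCoxeterSystem.IsReflection (w * M.toCoxeterSystem.simple i * w⁻¹) :=
        ⟨w, i, rfl⟩
      have h' : t = M.toCoxeterSystem.simple k * (w * M.toCoxeterSystem.simple i * w⁻¹) *
          M.toCoxeterSystem.simple k := by
        rw [show t = _ from h, mul_inv_rev, CoxeterSystem.inv_simple]
        simp only [mul_assoc]
      subst h'
      by_cases hk : w * M.toCoxeterSystem.simple i * w⁻¹ = M.toCoxeterSystem.simple k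
      · simp only [hk, CoxeterSystem.simple_mul_simple_self, one_mul, hg, reflD_simple]
      · rw [← hg' k ⟨_, ht'⟩ hk, ← hs_mul_reflD_mul_hs M k ⟨_, ht'⟩ hk, ih ⟨_, ht'⟩ rfl]
  funext t
  obtain ⟨w, i, h⟩ := t.2
  exact key w i t h

end HeckeHopfCox
end

section
/- For every Coxeter group W: (1) the canonical ℤ-algebra homomorphism from the ℤ-algebra presented by generators e_s (s ∈ 𝒮) and relations e_s² = e_s to Ĥ(W), sending e_s ↦ D_s, is injective; consequently the subalgebra D̂(W) of Ĥ(W) generated by {D_s : s ∈ 𝒮} is presented by the relations D_s² = D_s alone; and (2) Ĥ(W) factors as D̂(W)·ℤW: the ℤ-linear map D̂(W) ⊗_ℤ ℤ[W] → Ĥ(W) sending d ⊗ w to d·π(w) is a bijection, where ℤ[W] is the group algebra and π : W → Ĥ(W) is the canonical monoid homomorphism with π(s_i) = s_i. -/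
open scoped TensorProduct

namespace HeckeHopfCox

noncomputable def fe {B : Type*} (M : CoxeterMatrix B) (t : Refl M) :
    FreeAlgebra ℤ (Refl M) := FreeAlgebra.ι ℤ t

/-- The relations `e_s² = e_s`, `s ∈ 𝒮`. -/
inductive IdemRel {B : Type*} (M : CoxeterMatrix B) :
    FreeAlgebra ℤ (Refl M) → FreeAlgebra ℤ (Refl M) → Prop
  | idem (t : Refl M) : IdemRel M (fe M t * fe M t) (fe M t)

/-- The `ℤ`-algebra presented by generators `e_s`, `s ∈ 𝒮`, and relations `e_s² = e_s`. -/
abbrev FD {B : Type*} (M : CoxeterMatrix B) : Type _ := RingQuot (IdemRel M)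

/-- The image of the generator `e_s` in the presented algebra. -/
noncomputable def eg {B : Type*} (M : CoxeterMatrix B) (t : Refl M) : FD M :=
  RingQuot.mkAlgHom ℤ (IdemRel M) (fe M t)

section ReflectionOrder

open Module Polynomial.Chebyshev

variable {V : Type*} [AddCommGroup V] [Module ℝ V] {x y : V} {f g : Dual ℝ V}
  (hf : f x = 2) (hg : g y = 2) {m : ℕ}

include hf hg in
theorem reflection_mul_reflection_pow_eq_one_of_cos (hm : 2 ≤ m)
    (hfy : f y = -2 * Real.cos (Real.pi / m)) (hgx : g x = -2 * Real.cos (Real.pi / m)) :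
    (reflection hf * reflection hg) ^ m = 1 := by
  obtain rfl | hm3 := hm.eq_or_lt
  · have hfy' : f y = 0 := by simpa using hfy
    have hgx' : g x = 0 := by simpa using hgx
    ext z
    simp only [pow_two, LinearEquiv.mul_apply, reflection_apply, map_sub, map_smul, hf, hg, hfy',
      hgx', LinearEquiv.coe_one, id]
    module
  · have hm0 : (0 : ℝ) < m := by positivity
    have hm3' : (3 : ℝ) ≤ m := by exact_mod_cast hm3
    set θ : ℝ := 2 * (Real.pi / m) with hθ
    have hmθ : m * θ = 2 * Real.pi := by rw [hθ]; field_simp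
    have hsin : Real.sin θ ≠ 0 := by
      refine (Real.sin_pos_of_pos_of_lt_pi (by positivity) ?_).ne'
      nlinarith [Real.pi_pos]
    have ht : 2 * Real.cos θ = f y * g x - 2 := by
      rw [hfy, hgx, hθ, Real.cos_two_mul]; ring
    have hS (k : ℤ) : (S ℝ k).eval (2 * Real.cos θ) = Real.sin ((k + 1) * θ) / Real.sin θ :=
      eq_div_of_mul_eq hsin (S_two_mul_real_cos θ k)
    obtain ⟨k, rfl | rfl⟩ := m.even_or_odd'
    · have h1 : (((2 * k : ℕ) : ℤ) - 2) / 2 = k - 1 := by omega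
      have h2 : (((2 * k : ℕ) : ℤ) - 1) / 2 = k - 1 := by omega
      have hk : (S ℝ ((k : ℤ) - 1)).eval (2 * Real.cos θ) = 0 := by
        rw [hS]
        push_cast at hmθ ⊢
        rw [show ((k : ℝ) - 1 + 1) * θ = Real.pi by linarith]
        simp
      ext z
      rw [reflection_mul_reflection_pow_apply hf hg _ z _ ht, h1, h2, hk]
      simp
    · have h1 : (((2 * k + 1 : ℕ) : ℤ) - 2) / 2 = k - 1 := by omega
      have h2 : (((2 * k + 1 : ℕ) : ℤ) - 1) / 2 = k := by omega
      have h3 : (((2 * k + 1 : ℕ) : ℤ) - 3) / 2 = k - 1 := by omega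
      have h4 : (((2 * k + 1 : ℕ) : ℤ)) / 2 = k := by omega
      have hk : (S ℝ (k : ℤ)).eval (2 * Real.cos θ) +
          (S ℝ ((k : ℤ) - 1)).eval (2 * Real.cos θ) = 0 := by
        rw [hS, hS]
        push_cast at hmθ ⊢
        rw [show ((k : ℝ) - 1 + 1) * θ = 2 * Real.pi - (k + 1) * θ by linarith,
          Real.sin_two_pi_sub]
        ring
      ext z
      rw [reflection_mul_reflection_pow_apply hf hg _ z _ ht, h1, h2, h3, h4, hk]
      simp

include hf hg in
theorem reflection_mul_reflection_pow_ne_one_of_cos (hxy : LinearIndependent ℝ ![x, y])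
    (hfy : f y = -2 * Real.cos (Real.pi / m)) (hgx : g x = -2 * Real.cos (Real.pi / m))
    {n : ℕ} (hn : 0 < n) (hnm : n < m) :
    (reflection hf * reflection hg) ^ n ≠ 1 := by
  intro h
  have hm0 : (0 : ℝ) < m := by exact_mod_cast hn.trans hnm
  set θ : ℝ := 2 * (Real.pi / m) with hθ
  have ht : 2 * Real.cos θ = f y * g x - 2 := by
    rw [hfy, hgx, hθ, Real.cos_two_mul]; ring
  have hx := reflection_mul_reflection_pow_apply_self hf hg n _ ht
  rw [h, LinearEquiv.coe_one, id] at hx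
  have hlin := LinearIndependent.pair_iff.1 hxy
    ((S ℝ (n : ℤ)).eval (2 * Real.cos θ) + (S ℝ ((n : ℤ) - 1)).eval (2 * Real.cos θ) - 1)
    ((S ℝ ((n : ℤ) - 1)).eval (2 * Real.cos θ) * -g x) (by
      rw [sub_smul, one_smul, sub_add_eq_add_sub, ← hx, sub_self])
  obtain rfl | hm3 := (show 2 ≤ m by omega).eq_or_lt
  · obtain rfl : n = 1 := by omega
    have hc : θ = Real.pi := by rw [hθ]; push_cast; ring
    have := hlin.1
    rw [hc] at this
    norm_num [S_one] at this
  · have hm3' : (3 : ℝ) ≤ m := by exact_mod_cast hm3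
    have hsin : 0 < Real.sin θ := by
      refine Real.sin_pos_of_pos_of_lt_pi (by positivity) ?_
      rw [hθ, ← mul_div_assoc, div_lt_iff₀ hm0]
      nlinarith [Real.pi_pos]
    have hgx0 : g x ≠ 0 := by
      have : 0 < Real.cos (Real.pi / m) := by
        refine Real.cos_pos_of_mem_Ioo ⟨?_, ?_⟩
        · have : 0 < Real.pi / m := by positivity
          linarith [Real.pi_pos]
        · rw [div_lt_div_iff₀ hm0 two_pos]
          nlinarith [Real.pi_pos]
      rw [hgx]
      linarith
    have h1 : (S ℝ ((n : ℤ) - 1)).eval (2 * Real.cos θ) = 0 := by simpa [hgx0] using hlin.2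
    have h2 : (S ℝ (n : ℤ)).eval (2 * Real.cos θ) = 1 := by linarith [hlin.1]
    have h1' := S_two_mul_real_cos θ ((n : ℤ) - 1)
    have h2' := S_two_mul_real_cos θ (n : ℤ)
    rw [h1] at h1'
    rw [h2] at h2'
    push_cast at h1' h2'
    rw [zero_mul, sub_add_cancel] at h1'
    rw [add_mul, one_mul, one_mul, Real.sin_add, ← h1', zero_mul, zero_add] at h2'
    have hcos : Real.cos (n * θ) = 1 := mul_right_cancel₀ hsin.ne' (by rw [one_mul, ← h2'])
    have hθ0 : 0 < n * θ := by positivity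
    have hlt : n * θ < 2 * Real.pi := by
      have : (n : ℝ) < m := by exact_mod_cast hnm
      rw [hθ, show (n : ℝ) * (2 * (Real.pi / m)) = 2 * Real.pi * (n / m) by ring]
      have h' : (n : ℝ) / m < 1 := (div_lt_one hm0).2 this
      nlinarith [Real.pi_pos]
    exact hθ0.ne' ((Real.cos_eq_one_iff_of_lt_of_lt (by linarith [Real.pi_pos]) hlt).1 hcos)

end ReflectionOrder

section CoxeterOrder

open Module

variable {B : Type*} (M : CoxeterMatrix B)

/-- The coroot functional of the geometric representation attached to `i`. -/
noncomputable def geomCoroot (i : B) : Dual ℝ (B →₀ ℝ) :=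
  Finsupp.linearCombination ℝ fun j ↦ -2 * Real.cos (Real.pi / M i j)

theorem geomCoroot_single (i j : B) :
    geomCoroot M i (Finsupp.single j 1) = -2 * Real.cos (Real.pi / M i j) := by
  simp [geomCoroot]

theorem geomCoroot_single_self (i : B) : geomCoroot M i (Finsupp.single i 1) = 2 := by
  simp [geomCoroot_single]

theorem two_le_of_ne {i j : B} (hij : i ≠ j) (h0 : M i j ≠ 0) : 2 ≤ M i j := by
  have := M.off_diagonal i j hij
  omega

theorem isLiftable_geom : M.IsLiftable fun i ↦ reflection (geomCoroot_single_self M i) := by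
  intro i j
  by_cases hij : i = j
  · subst hij
    rw [M.diagonal, pow_one]
    ext1 z
    exact involutive_reflection (geomCoroot_single_self M i) z
  by_cases h0 : M i j = 0
  · rw [h0, pow_zero]
  · exact reflection_mul_reflection_pow_eq_one_of_cos _ _ (two_le_of_ne M hij h0)
      (geomCoroot_single M i j) (by rw [geomCoroot_single, M.symmetric])

theorem simple_mul_simple_pow_ne_one {W : Type*} [Group W] (cs : CoxeterSystem M W) {i j : B}
    (hij : i ≠ j) {n : ℕ} (hn : 0 < n) (hnm : n < M i j) :
    (cs.simple i * cs.simple j) ^ n ≠ 1 := by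
  intro h
  have h' := congrArg (cs.lift ⟨_, isLiftable_geom M⟩) h
  rw [map_pow, map_mul, cs.lift_apply_simple, cs.lift_apply_simple, map_one] at h'
  refine reflection_mul_reflection_pow_ne_one_of_cos (geomCoroot_single_self M i)
    (geomCoroot_single_self M j) ?_ (geomCoroot_single M i j)
    (by rw [geomCoroot_single, M.symmetric]) hn hnm h'
  refine LinearIndependent.pair_iff.2 fun s t hst ↦ ⟨?_, ?_⟩
  · simpa [hij.symm, hij] using DFunLike.congr_fun hst i
  · simpa [hij.symm, hij] using DFunLike.congr_fun hst j

end CoxeterOrder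

section AlternatingProducts

variable {G : Type*}

/-- The alternating product `x * y * x * ⋯` with `k` factors, starting with `x`. -/
def altProd [Monoid G] (x y : G) : ℕ → G
  | 0 => 1
  | k + 1 => x * altProd y x k

theorem map_altProd {H : Type*} [Monoid G] [Monoid H] (f : G →* H) (x y : G) (k : ℕ) :
    f (altProd x y k) = altProd (f x) (f y) k := by
  induction k generalizing x y with
  | zero => exact map_one f
  | succ k ih => rw [altProd, map_mul, ih, altProd]

theorem altProd_succ' [Monoid G] (x y : G) (k : ℕ) :
    altProd x y (k + 1) = altProd x y k * if k % 2 = 0 then x else y := by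
  induction k generalizing x y with
  | zero => simp [altProd]
  | succ k ih =>
    rw [altProd, ih, altProd, mul_assoc]
    rcases Nat.mod_two_eq_zero_or_one k with h | h <;>
      simp [h, Nat.add_mod]

theorem altProd_two_mul [Monoid G] (x y : G) (k : ℕ) : altProd x y (2 * k) = (x * y) ^ k := by
  induction k with
  | zero => simp [altProd]
  | succ k ih => rw [Nat.mul_succ, altProd, altProd, ih, pow_succ', mul_assoc]

theorem mul_altProd_inv [Group G] {x y : G} (hx : x * x = 1) (hy : y * y = 1) (k : ℕ) :
    altProd x y k * (altProd y x k)⁻¹ = (x * y) ^ k := by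
  induction k generalizing x y with
  | zero => simp [altProd]
  | succ k ih =>
    rw [altProd, altProd, mul_inv_rev, mul_assoc x, ← mul_assoc (altProd y x k), ih hy hx,
      inv_eq_of_mul_eq_one_left hy]
    rw [← mul_assoc, ← mul_pow_mul, mul_assoc, ← pow_succ]

end AlternatingProducts

section SignedReflections

variable {B : Type*} {M : CoxeterMatrix B} {W : Type*} [Group W] (cs : CoxeterSystem M W)

open scoped Classical in
/-- The action of the simple reflection `sᵢ` on signed elements: conjugation by `sᵢ`, with a change
of sign exactly at `sᵢ` itself. -/
noncomputable def signedConj (i : B) : Equiv.Perm (W × ZMod 2) :=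
  Function.Involutive.toPerm
    (fun p ↦ (cs.simple i * p.1 * cs.simple i, p.2 + if p.1 = cs.simple i then 1 else 0)) (by
      rintro ⟨g, ε⟩
      have h : cs.simple i * g * cs.simple i = cs.simple i ↔ g = cs.simple i := by
        rw [mul_eq_right, mul_eq_one_iff_inv_eq, cs.inv_simple, eq_comm]
      ext1
      · simp [mul_assoc]
      · simp only [h]
        split_ifs <;> simp [add_assoc, CharTwo.add_self_eq_zero])

open scoped Classical in
theorem signedConj_apply (i : B) (g : W) (ε : ZMod 2) :
    signedConj cs i (g, ε) =
      (cs.simple i * g * cs.simple i, ε + if g = cs.simple i then 1 else 0) :=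
  rfl

theorem signedConj_mul_self (i : B) : signedConj cs i * signedConj cs i = 1 := by
  ext1 p
  exact Function.Involutive.toPerm_involutive _ p

open scoped Classical in
theorem altProd_signedConj_inv_apply (i j : B) (k : ℕ) (g : W) (ε : ZMod 2) :
    (altProd (signedConj cs i) (signedConj cs j) k)⁻¹ (g, ε) =
      ((altProd (cs.simple i) (cs.simple j) k)⁻¹ * g * altProd (cs.simple i) (cs.simple j) k,
        ε + ∑ l ∈ Finset.range k,
          if g = cs.simple i * (cs.simple j * cs.simple i) ^ l then 1 else 0) := by
  induction k generalizing i j g ε with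
  | zero => simp [altProd]
  | succ k ih =>
    rw [altProd, altProd, mul_inv_rev, Equiv.Perm.mul_apply,
      inv_eq_of_mul_eq_one_left (signedConj_mul_self cs i), signedConj_apply, ih,
      Finset.sum_range_succ']
    refine Prod.ext (by simp [mul_assoc]) ?_
    have h (l : ℕ) : cs.simple i * g * cs.simple i =
        cs.simple j * (cs.simple i * cs.simple j) ^ l ↔
        g = cs.simple i * (cs.simple j * cs.simple i) ^ (l + 1) := by
      rw [← mul_left_inj (cs.simple i), ← mul_right_inj (cs.simple i)]
      simp only [mul_assoc, cs.simple_mul_simple_self, cs.simple_mul_simple_cancel_left, mul_one,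
        mul_pow_mul, pow_succ']
    simp only [h, pow_zero, mul_one]
    ring

theorem isLiftable_signedConj : M.IsLiftable (signedConj cs) := by
  classical
  intro i j
  rw [← altProd_two_mul, ← inv_eq_one]
  ext1 ⟨g, ε⟩
  rw [altProd_signedConj_inv_apply, altProd_two_mul, cs.simple_mul_simple_pow, two_mul,
    Finset.sum_range_add]
  simp only [pow_add, M.symmetric i j, cs.simple_mul_simple_pow, one_mul,
    CharTwo.add_self_eq_zero]
  simp

/-- The action of the Coxeter group on signed reflections. -/
noncomputable def signedConjHom : W →* Equiv.Perm (W × ZMod 2) :=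
  cs.lift ⟨_, isLiftable_signedConj cs⟩

theorem signedConjHom_simple (i : B) : signedConjHom cs (cs.simple i) = signedConj cs i :=
  cs.lift_apply_simple _ i

/-- The sign picked up by `t` under the action of `w` on signed reflections: it is `1` when `t` is
a right inversion of `w` and `0` otherwise. -/
noncomputable def inversionSign (w t : W) : ZMod 2 := (signedConjHom cs w (t, 0)).2

theorem signedConjHom_apply (w t : W) (ε : ZMod 2) :
    signedConjHom cs w (t, ε) = (w * t * w⁻¹, ε + inversionSign cs w t) := by
  have key : ∀ w : W, ∀ t ε, signedConjHom cs w (t, ε) =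
      (w * t * w⁻¹, ε + (signedConjHom cs w (t, 0)).2) := by
    intro w
    induction w using cs.simple_induction_left with
    | one => simp
    | mul_simple_left w i ih =>
      intro t ε
      rw [map_mul, Equiv.Perm.mul_apply, Equiv.Perm.mul_apply, ih t ε, ih t 0,
        signedConjHom_simple, signedConj_apply, signedConj_apply]
      simp [mul_assoc, add_assoc]
  exact key w t ε

theorem inversionSign_mul (v w t : W) :
    inversionSign cs (v * w) t = inversionSign cs w t + inversionSign cs v (w * t * w⁻¹) := by
  rw [inversionSign, map_mul, Equiv.Perm.mul_apply, signedConjHom_apply, signedConjHom_apply,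
    zero_add]

theorem inversionSign_one (t : W) : inversionSign cs 1 t = 0 := by
  simp [inversionSign]

open scoped Classical in
theorem inversionSign_simple (i : B) (t : W) :
    inversionSign cs (cs.simple i) t = if t = cs.simple i then 1 else 0 := by
  rw [inversionSign, signedConjHom_simple, signedConj_apply, zero_add]

theorem inversionSign_self {t : W} (ht : cs.IsReflection t) : inversionSign cs t t = 1 := by
  obtain ⟨w, i, rfl⟩ := ht
  have h := inversionSign_mul cs w w⁻¹ (w * cs.simple i * w⁻¹)
  rw [mul_inv_cancel, inversionSign_one, inv_inv,
    show w⁻¹ * (w * cs.simple i * w⁻¹) * w = cs.simple i by group] at h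
  rw [inversionSign_mul, inversionSign_mul, inversionSign_simple,
    show w⁻¹ * (w * cs.simple i * w⁻¹) * w⁻¹⁻¹ = cs.simple i by group,
    cs.inv_simple, cs.simple_mul_simple_self, one_mul, if_pos rfl, add_left_comm, ← h, add_zero]

theorem inversionSign_mul_self_right {t : W} (ht : cs.IsReflection t) (w : W) :
    inversionSign cs (w * t) t = inversionSign cs w t + 1 := by
  rw [inversionSign_mul, inversionSign_self cs ht, ht.inv, mul_assoc, ht.mul_self, mul_one,
    add_comm]

theorem inversionSign_altProd_inv (i j : B) (hij : i ≠ j) :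
    inversionSign cs (altProd (cs.simple j) (cs.simple i) (M i j - 1))⁻¹ (cs.simple i) = 0 := by
  classical
  rw [inversionSign, map_inv, map_altProd, signedConjHom_simple, signedConjHom_simple,
    altProd_signedConj_inv_apply, zero_add]
  dsimp only
  refine Finset.sum_eq_zero fun l hl ↦ if_neg fun h ↦ ?_
  rw [Finset.mem_range] at hl
  refine simple_mul_simple_pow_ne_one M cs hij (n := l + 1) (by omega) (by omega) ?_
  rw [pow_succ', mul_assoc, ← h, cs.simple_mul_simple_self]

theorem altProd_inv_mul_simple_mul_altProd (i j : B) (h0 : M i j ≠ 0) :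
    (altProd (cs.simple j) (cs.simple i) (M i j - 1))⁻¹ * cs.simple i *
      altProd (cs.simple j) (cs.simple i) (M i j - 1) =
      cs.simple (if M i j % 2 = 0 then i else j) := by
  obtain ⟨m, hm⟩ := Nat.exists_eq_succ_of_ne_zero h0
  have h := mul_altProd_inv (cs.simple_mul_simple_self i) (cs.simple_mul_simple_self j) (M i j)
  rw [cs.simple_mul_simple_pow, mul_inv_eq_one, hm, altProd, altProd_succ'] at h
  rw [hm, Nat.succ_sub_one, mul_assoc, h, inv_mul_cancel_left]
  rcases Nat.mod_two_eq_zero_or_one m with h' | h' <;> simp [h', Nat.add_mod, Nat.succ_eq_add_one]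

end SignedReflections

section DemazureOperators

variable {B : Type*} {M : CoxeterMatrix B} {W : Type*} [Group W] (cs : CoxeterSystem M W)
  {A N : Type*} [Ring A] [AddCommGroup N] [Module A N] (e : W → A)

variable (W N) in
/-- The left translation action of `W` on functions `W → N`. -/
def translation : W →* Module.End ℤ (W → N) where
  toFun w := LinearMap.funLeft ℤ N (w⁻¹ * ·)
  map_one' := by ext; simp
  map_mul' v w := by ext; simp [mul_assoc]

theorem translation_apply (w : W) (f : W → N) (x : W) : translation W N w f x = f (w⁻¹ * x) :=
  rfl

variable (N) in
open scoped Classical in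
/-- The Demazure-type operator attached to `t`, acting on functions `W → N` through the values of
`e` on the conjugates of `t`. -/
noncomputable def demazure (t : W) : Module.End ℤ (W → N) :=
  AddMonoidHom.toIntLinearMap
    { toFun f x := if inversionSign cs x⁻¹ t = 0 then e (x⁻¹ * t * x) • f x
        else (1 - e (x⁻¹ * t * x)) • f x - f (t * x)
      map_zero' := by ext; simp
      map_add' f g := by
        ext x
        dsimp only [Pi.add_apply]
        split_ifs
        · rw [smul_add]
        · rw [smul_add]
          abel }

open scoped Classical in
theorem demazure_apply (t : W) (f : W → N) (x : W) :
    demazure cs N e t f x = if inversionSign cs x⁻¹ t = 0 then e (x⁻¹ * t * x) • f x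
      else (1 - e (x⁻¹ * t * x)) • f x - f (t * x) :=
  rfl

theorem demazure_apply_one (t : W) (f : W → N) : demazure cs N e t f 1 = e t • f 1 := by
  simp [demazure_apply, inversionSign_one]

variable {e} {t : W}

open scoped Classical in
theorem demazure_apply_mul_left (ht : cs.IsReflection t) (f : W → N) (x : W) :
    demazure cs N e t f (t * x) =
      if inversionSign cs x⁻¹ t = 0 then (1 - e (x⁻¹ * t * x)) • f (t * x) - f x
      else e (x⁻¹ * t * x) • f (t * x) := by
  have h : ∀ a : ZMod 2, a + 1 = 0 ↔ ¬ a = 0 := by decide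
  have hconj : (t * x)⁻¹ * t * (t * x) = x⁻¹ * t * x := by group
  have hmul : t * (t * x) = x := by rw [← mul_assoc, ht.mul_self, one_mul]
  rw [demazure_apply, hconj, hmul, mul_inv_rev, ht.inv, inversionSign_mul_self_right cs ht]
  simp only [h, ite_not]

theorem demazure_mul_self (he : ∀ g, IsIdempotentElem (e g)) (ht : cs.IsReflection t) :
    demazure cs N e t * demazure cs N e t = demazure cs N e t := by
  ext f x
  have h := (he (x⁻¹ * t * x)).eq
  have h' := (he (x⁻¹ * t * x)).one_sub.eq
  rw [Module.End.mul_apply, demazure_apply, demazure_apply_mul_left cs ht, demazure_apply]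
  split_ifs
  · rw [smul_smul, h]
  · rw [smul_sub, smul_smul, h', sub_smul, sub_smul, one_smul, one_smul]
    abel

theorem translation_mul_demazure_add (ht : cs.IsReflection t) :
    translation W N t * demazure cs N e t + demazure cs N e t * translation W N t =
      translation W N t - 1 := by
  ext f x
  rw [LinearMap.add_apply, Pi.add_apply, Module.End.mul_apply, Module.End.mul_apply,
    translation_apply, ht.inv, demazure_apply_mul_left cs ht, demazure_apply]
  simp only [LinearMap.sub_apply, Pi.sub_apply, translation_apply, ht.inv, Module.End.one_apply]
  rw [← mul_assoc t t x, ht.mul_self, one_mul]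
  split_ifs
  · rw [sub_smul, one_smul]
    abel
  · rw [sub_smul, one_smul]
    abel

theorem demazure_mul_translation {w : W} (h : inversionSign cs w⁻¹ t = 0) :
    demazure cs N e t * translation W N w = translation W N w * demazure cs N e (w⁻¹ * t * w) := by
  ext f x
  have hs := inversionSign_mul cs (x⁻¹ * w) w⁻¹ t
  rw [mul_inv_cancel_right, h, zero_add, inv_inv] at hs
  have hx : (w⁻¹ * x)⁻¹ = x⁻¹ * w := by group
  have hc : x⁻¹ * w * (w⁻¹ * t * w) * (w⁻¹ * x) = x⁻¹ * t * x := by group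
  have ht : w⁻¹ * t * w * (w⁻¹ * x) = w⁻¹ * (t * x) := by group
  simp only [Module.End.mul_apply, demazure_apply, translation_apply, hs, hx, hc, ht]

end DemazureOperators

section Representation

variable {B : Type*} (M : CoxeterMatrix B) {A N : Type*} [Ring A] [AddCommGroup N] [Module A N]
  {e : M.Group → A}

theorem altS_eq_altProd (i j : B) (k : ℕ) : altS i j k = altProd (fs i) (fs j) k := by
  induction k generalizing i j with
  | zero => rfl
  | succ k ih => rw [altS, altProd, ih]

variable (N e) in
/-- The operators by which the generators of `Ĥ(W)` act on functions `W → N`. -/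
noncomputable def genAction : Gen B → Module.End ℤ (M.Group → N)
  | .s i => translation M.Group N (M.toCoxeterSystem.simple i)
  | .D i => demazure M.toCoxeterSystem N e (M.toCoxeterSystem.simple i)

theorem lift_genAction_fs (i : B) :
    FreeAlgebra.lift ℤ (genAction M N e) (fs i) =
      translation M.Group N (M.toCoxeterSystem.simple i) :=
  FreeAlgebra.lift_ι_apply _ _

theorem lift_genAction_fD (i : B) :
    FreeAlgebra.lift ℤ (genAction M N e) (fD i) =
      demazure M.toCoxeterSystem N e (M.toCoxeterSystem.simple i) :=
  FreeAlgebra.lift_ι_apply _ _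

theorem lift_genAction_altS (i j : B) (k : ℕ) :
    FreeAlgebra.lift ℤ (genAction M N e) (altS i j k) =
      translation M.Group N
        (altProd (M.toCoxeterSystem.simple i) (M.toCoxeterSystem.simple j) k) := by
  rw [altS_eq_altProd, map_altProd, ← lift_genAction_fs M (e := e), ← lift_genAction_fs M (e := e)]
  exact map_altProd (FreeAlgebra.lift ℤ (genAction M N e)).toMonoidHom _ _ k

theorem lift_genAction_rel (he : ∀ g, IsIdempotentElem (e g)) ⦃a b : F B⦄ (h : Rel M a b) :
    FreeAlgebra.lift ℤ (genAction M N e) a = FreeAlgebra.lift ℤ (genAction M N e) b := by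
  have hr (i : B) := M.toCoxeterSystem.isReflection_simple i
  cases h with
  | s_sq i =>
    rw [map_mul, lift_genAction_fs, ← map_mul, CoxeterSystem.simple_mul_simple_self, map_one,
      map_one]
  | D_sq i => rw [map_mul, lift_genAction_fD, demazure_mul_self _ he (hr i)]
  | sD i =>
    rw [map_add, map_mul, map_mul, map_sub, map_one, lift_genAction_fD, lift_genAction_fs,
      translation_mul_demazure_add _ (hr i)]
  | coxeter i j =>
    rw [map_pow, map_mul, lift_genAction_fs, lift_genAction_fs, ← map_mul, ← map_pow,
      CoxeterSystem.simple_mul_simple_pow, map_one, map_one]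
  | braidLin i j hij h0 =>
    rw [map_mul, map_mul, lift_genAction_fD, lift_genAction_fD, lift_genAction_altS,
      demazure_mul_translation _ (inversionSign_altProd_inv _ i j hij),
      altProd_inv_mul_simple_mul_altProd _ i j h0]

variable (N) in
/-- The representation of `Ĥ(W)` on functions `W → N` by translations and Demazure operators. -/
noncomputable def demazureRep (he : ∀ g, IsIdempotentElem (e g)) :
    HW M →ₐ[ℤ] Module.End ℤ (M.Group → N) :=
  RingQuot.liftAlgHom ℤ ⟨FreeAlgebra.lift ℤ (genAction M N e), lift_genAction_rel M he⟩

variable (he : ∀ g, IsIdempotentElem (e g))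

theorem demazureRep_hs (i : B) :
    demazureRep M N he (hs M i) = translation M.Group N (M.toCoxeterSystem.simple i) := by
  rw [demazureRep, hs, RingQuot.liftAlgHom_mkAlgHom_apply, lift_genAction_fs]

theorem demazureRep_hD (i : B) :
    demazureRep M N he (hD M i) = demazure M.toCoxeterSystem N e (M.toCoxeterSystem.simple i) := by
  rw [demazureRep, hD, RingQuot.liftAlgHom_mkAlgHom_apply, lift_genAction_fD]

end Representation

section Reflections

variable {B : Type*} (M : CoxeterMatrix B)

theorem refl_induction {p : Refl M → Prop}
    (simple : ∀ (i : B) (h : M.toCoxeterSystem.IsReflection (M.toCoxeterSystem.simple i)),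
      p ⟨M.toCoxeterSystem.simple i, h⟩)
    (conj : ∀ (i : B) (t : Refl M), (t : M.Group) ≠ M.toCoxeterSystem.simple i →
      ∀ h : M.toCoxeterSystem.IsReflection
        (M.toCoxeterSystem.simple i * (t : M.Group) * M.toCoxeterSystem.simple i), p t →
      p ⟨M.toCoxeterSystem.simple i * (t : M.Group) * M.toCoxeterSystem.simple i, h⟩)
    (t : Refl M) : p t := by
  obtain ⟨t, ht⟩ := t
  obtain ⟨w, i, hw⟩ := id ht
  induction w using M.toCoxeterSystem.simple_induction_left generalizing t with
  | one =>
    obtain rfl : t = M.toCoxeterSystem.simple i := by simpa using hw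
    exact simple i ht
  | mul_simple_left w j ih =>
    have hr : M.toCoxeterSystem.IsReflection (w * M.toCoxeterSystem.simple i * w⁻¹) := ⟨w, i, rfl⟩
    by_cases hj : w * M.toCoxeterSystem.simple i * w⁻¹ = M.toCoxeterSystem.simple j
    · obtain rfl : t = M.toCoxeterSystem.simple j := by
        rw [hw, mul_inv_rev, mul_assoc, mul_assoc, ← mul_assoc w, ← mul_assoc _ w⁻¹, hj]
        simp
      exact simple j ht
    · have ht' : t = M.toCoxeterSystem.simple j * (w * M.toCoxeterSystem.simple i * w⁻¹) *
          M.toCoxeterSystem.simple j := by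
        rw [hw, mul_inv_rev, CoxeterSystem.inv_simple]
        simp only [mul_assoc]
      subst ht'
      exact conj j ⟨_, hr⟩ hj ht (ih _ hr rfl)

theorem hs_mul_self (i : B) : hs M i * hs M i = 1 := by
  rw [hs, ← map_mul, RingQuot.mkAlgHom_rel ℤ (Rel.s_sq i), map_one]

theorem hD_mul_self (i : B) : hD M i * hD M i = hD M i := by
  rw [hD, ← map_mul, RingQuot.mkAlgHom_rel ℤ (Rel.D_sq i)]

theorem hs_mul_hD (i : B) : hs M i * hD M i = (1 - hD M i) * hs M i - 1 := by
  have h := RingQuot.mkAlgHom_rel ℤ (Rel.sD (M := M) i)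
  rw [map_add, map_mul, map_mul, map_sub, map_one] at h
  rw [sub_mul, one_mul, sub_right_comm]
  exact eq_sub_of_add_eq h

open scoped Classical in
/-- The generators of the presented algebra, extended by zero to all elements of the group. -/
noncomputable def egExt (g : M.Group) : FD M :=
  if h : M.toCoxeterSystem.IsReflection g then eg M ⟨g, h⟩ else 0

theorem egExt_coe (t : Refl M) : egExt M t = eg M t :=
  dif_pos t.2

theorem isIdempotentElem_eg (t : Refl M) : IsIdempotentElem (eg M t) := by
  rw [IsIdempotentElem, eg, ← map_mul, RingQuot.mkAlgHom_rel ℤ (IdemRel.idem t)]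

theorem isIdempotentElem_egExt (g : M.Group) : IsIdempotentElem (egExt M g) := by
  rw [egExt]
  split_ifs
  · exact isIdempotentElem_eg M _
  · exact IsIdempotentElem.zero

theorem induction_FD {p : FD M → Prop} (algebraMap : ∀ n : ℤ, p (algebraMap ℤ (FD M) n))
    (eg : ∀ t, p (eg M t)) (mul : ∀ a b, p a → p b → p (a * b))
    (add : ∀ a b, p a → p b → p (a + b)) (d : FD M) : p d := by
  obtain ⟨d, rfl⟩ := RingQuot.mkAlgHom_surjective ℤ (IdemRel M) d
  induction d with
  | grade0 n =>
    rw [AlgHom.commutes]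
    exact algebraMap n
  | grade1 t => exact eg t
  | mul a b ha hb =>
    rw [map_mul]
    exact mul _ _ ha hb
  | add a b ha hb =>
    rw [map_add]
    exact add _ _ ha hb

theorem induction_HW {p : HW M → Prop} (algebraMap : ∀ n : ℤ, p (algebraMap ℤ (HW M) n))
    (hs : ∀ i, p (hs M i)) (hD : ∀ i, p (hD M i)) (mul : ∀ a b, p a → p b → p (a * b))
    (add : ∀ a b, p a → p b → p (a + b)) (a : HW M) : p a := by
  obtain ⟨a, rfl⟩ := RingQuot.mkAlgHom_surjective ℤ (Rel M) a
  induction a using FreeAlgebra.induction with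
  | grade0 n =>
    rw [AlgHom.commutes]
    exact algebraMap n
  | grade1 x =>
    cases x with
    | s i => exact hs i
    | D i => exact hD i
  | mul a b ha hb =>
    rw [map_mul]
    exact mul _ _ ha hb
  | add a b ha hb =>
    rw [map_add]
    exact add _ _ ha hb

/-- The defining properties of the family `(D_s)` indexed by the reflections. -/
structure IsReflFamily (Dfam : Refl M → HW M) : Prop where
  simple : ∀ (i : B) (h : M.toCoxeterSystem.IsReflection (M.toCoxeterSystem.simple i)),
    Dfam ⟨M.toCoxeterSystem.simple i, h⟩ = hD M i
  conj : ∀ (i : B) (t : Refl M), (t : M.Group) ≠ M.toCoxeterSystem.simple i →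
    ∀ h : M.toCoxeterSystem.IsReflection
      (M.toCoxeterSystem.simple i * (t : M.Group) * M.toCoxeterSystem.simple i),
    hs M i * Dfam t * hs M i =
      Dfam ⟨M.toCoxeterSystem.simple i * (t : M.Group) * M.toCoxeterSystem.simple i, h⟩

namespace IsReflFamily

variable {M} {Dfam : Refl M → HW M} (hD : IsReflFamily M Dfam)

include hD

theorem isIdempotentElem (t : Refl M) : IsIdempotentElem (Dfam t) := by
  induction t using refl_induction with
  | simple i h => rw [hD.simple, IsIdempotentElem, hD_mul_self]
  | conj i t hne h ih =>
    rw [← hD.conj i t hne h, IsIdempotentElem,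
      show hs M i * Dfam t * hs M i * (hs M i * Dfam t * hs M i) =
        hs M i * Dfam t * (hs M i * hs M i) * Dfam t * hs M i by simp only [mul_assoc],
      hs_mul_self, mul_one, mul_assoc (hs M i), ih.eq]

theorem demazureRep_apply {A N : Type*} [Ring A] [AddCommGroup N] [Module A N] {e : M.Group → A}
    (he : ∀ g, IsIdempotentElem (e g)) (t : Refl M) :
    demazureRep M N he (Dfam t) = demazure M.toCoxeterSystem N e t := by
  classical
  induction t using refl_induction with
  | simple i h => rw [hD.simple, demazureRep_hD]
  | conj i t hne h ih =>
    have hsign : inversionSign M.toCoxeterSystem (M.toCoxeterSystem.simple i)⁻¹ t = 0 := by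
      rw [CoxeterSystem.inv_simple, inversionSign_simple, if_neg hne]
    rw [← hD.conj i t hne h, map_mul, map_mul, ih, demazureRep_hs, mul_assoc,
      demazure_mul_translation _ hsign, ← mul_assoc, ← map_mul,
      CoxeterSystem.simple_mul_simple_self, map_one, one_mul, CoxeterSystem.inv_simple]

/-- The canonical homomorphism `e_s ↦ D_s` from the presented algebra to `Ĥ(W)`. -/
noncomputable def canonicalHom : FD M →ₐ[ℤ] HW M :=
  RingQuot.liftAlgHom ℤ ⟨FreeAlgebra.lift ℤ Dfam, by
    rintro _ _ ⟨t⟩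
    rw [map_mul, fe, FreeAlgebra.lift_ι_apply, (hD.isIdempotentElem t).eq]⟩

theorem canonicalHom_eg (t : Refl M) : hD.canonicalHom (eg M t) = Dfam t := by
  rw [canonicalHom, eg, RingQuot.liftAlgHom_mkAlgHom_apply, fe, FreeAlgebra.lift_ι_apply]

theorem range_canonicalHom :
    hD.canonicalHom.range = Algebra.adjoin ℤ (Set.range Dfam) := by
  apply le_antisymm
  · rintro _ ⟨d, rfl⟩
    change hD.canonicalHom d ∈ _
    induction d using induction_FD with
    | algebraMap n =>
      rw [AlgHom.commutes]
      exact Subalgebra.algebraMap_mem _ n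
    | eg t =>
      rw [canonicalHom_eg]
      exact Algebra.subset_adjoin ⟨t, rfl⟩
    | mul a b ha hb =>
      rw [map_mul]
      exact mul_mem ha hb
    | add a b ha hb =>
      rw [map_add]
      exact add_mem ha hb
  · refine Algebra.adjoin_le ?_
    rintro _ ⟨t, rfl⟩
    exact ⟨eg M t, hD.canonicalHom_eg t⟩

theorem demazureRep_canonicalHom_apply_one {N : Type*} [AddCommGroup N] [Module (FD M) N]
    (d : FD M) (f : M.Group → N) :
    demazureRep M N (isIdempotentElem_egExt M) (hD.canonicalHom d) f 1 = d • f 1 := by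
  induction d using induction_FD generalizing f with
  | algebraMap n => simp [Int.cast_smul_eq_zsmul]
  | eg t => rw [canonicalHom_eg, hD.demazureRep_apply, demazure_apply_one, egExt_coe]
  | mul a b ha hb => rw [map_mul, map_mul, Module.End.mul_apply, ha, hb, mul_smul]
  | add a b ha hb =>
    rw [map_add, map_add, LinearMap.add_apply, Pi.add_apply, ha, hb, add_smul]

theorem hs_mul_mem_adjoin (i : B) {d : HW M} (hd : d ∈ Algebra.adjoin ℤ (Set.range Dfam)) :
    ∃ a ∈ Algebra.adjoin ℤ (Set.range Dfam), ∃ b ∈ Algebra.adjoin ℤ (Set.range Dfam),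
      hs M i * d = a * hs M i + b := by
  induction hd using Algebra.adjoin_induction with
  | mem _ h =>
    obtain ⟨t, rfl⟩ := h
    have hmem (t : Refl M) : Dfam t ∈ Algebra.adjoin ℤ (Set.range Dfam) :=
      Algebra.subset_adjoin ⟨t, rfl⟩
    by_cases ht : (t : M.Group) = M.toCoxeterSystem.simple i
    · refine ⟨1 - Dfam t, sub_mem (one_mem _) (hmem t), -1, neg_mem (one_mem _), ?_⟩
      obtain ⟨t, hr⟩ := t
      subst ht
      rw [hD.simple, hs_mul_hD, sub_eq_add_neg]
    · have hr : M.toCoxeterSystem.IsReflection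
          (M.toCoxeterSystem.simple i * (t : M.Group) * M.toCoxeterSystem.simple i) := by
        have h := t.2.conj (M.toCoxeterSystem.simple i)
        rwa [CoxeterSystem.inv_simple] at h
      refine ⟨_, hmem ⟨_, hr⟩, 0, zero_mem _, ?_⟩
      rw [← hD.conj i t ht hr, mul_assoc, hs_mul_self, mul_one, add_zero]
  | algebraMap n =>
    exact ⟨_, Subalgebra.algebraMap_mem _ n, 0, zero_mem _, by rw [add_zero, Algebra.commutes]⟩
  | add x y _ _ hx hy =>
    obtain ⟨a, ha, b, hb, h⟩ := hx
    obtain ⟨a', ha', b', hb', h'⟩ := hy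
    exact ⟨a + a', add_mem ha ha', b + b', add_mem hb hb', by rw [mul_add, h, h']; noncomm_ring⟩
  | mul x y _ hym hx hy =>
    obtain ⟨a, ha, b, hb, h⟩ := hx
    obtain ⟨a', ha', b', hb', h'⟩ := hy
    refine ⟨a * a', mul_mem ha ha', a * b' + b * y,
      add_mem (mul_mem ha hb') (mul_mem hb hym), ?_⟩
    rw [← mul_assoc, h, add_mul, mul_assoc, h']
    noncomm_ring

end IsReflFamily

end Reflections

section Factorization

variable {B : Type*} {M : CoxeterMatrix B} {π : M.Group →* HW M} {Dfam : Refl M → HW M}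

variable (π Dfam) in
/-- The multiplication map `D̂(W) ⊗ ℤ[W] → Ĥ(W)`. -/
noncomputable def factorMap :
    (Algebra.adjoin ℤ (Set.range Dfam)) ⊗[ℤ] (MonoidAlgebra ℤ M.Group) →ₗ[ℤ] HW M :=
  LinearMap.mul' ℤ (HW M) ∘ₗ TensorProduct.map (Algebra.adjoin ℤ (Set.range Dfam)).val.toLinearMap
    (MonoidAlgebra.lift ℤ (HW M) M.Group π).toLinearMap

theorem factorMap_tmul_of (d : Algebra.adjoin ℤ (Set.range Dfam)) (w : M.Group) :
    factorMap π Dfam (d ⊗ₜ[ℤ] MonoidAlgebra.of ℤ M.Group w) = d * π w := by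
  change (d : HW M) * MonoidAlgebra.lift ℤ (HW M) M.Group π (MonoidAlgebra.of ℤ M.Group w) = _
  rw [MonoidAlgebra.lift_of]

theorem demazureRep_map {A N : Type*} [Ring A] [AddCommGroup N] [Module A N] {e : M.Group → A}
    (he : ∀ g, IsIdempotentElem (e g))
    (hπ : ∀ i, π (M.toCoxeterSystem.simple i) = hs M i) (w : M.Group) :
    demazureRep M N he (π w) = translation M.Group N w := by
  have h : (demazureRep M N he).toMonoidHom.comp π = translation M.Group N :=
    M.toCoxeterSystem.ext_simple fun i ↦ by
      change demazureRep M N he (π _) = _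
      rw [hπ, demazureRep_hs]
  exact DFunLike.congr_fun h w

namespace IsReflFamily

variable (hD : IsReflFamily M Dfam) (hπ : ∀ i, π (M.toCoxeterSystem.simple i) = hs M i)

include hD

theorem canonicalHom_injective : Function.Injective hD.canonicalHom := by
  intro a b hab
  have h := hD.demazureRep_canonicalHom_apply_one a fun _ ↦ (1 : FD M)
  rw [hab, hD.demazureRep_canonicalHom_apply_one] at h
  simpa using h.symm

/-- The inverse of the canonical homomorphism, written on `D̂(W)`-combinations of elements of `W`. -/
noncomputable def tensorOfFinsupp : (M.Group →₀ FD M) →ₗ[ℤ]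
    (Algebra.adjoin ℤ (Set.range Dfam)) ⊗[ℤ] (MonoidAlgebra ℤ M.Group) :=
  Finsupp.lsum ℤ fun w ↦
    (TensorProduct.mk ℤ _ (MonoidAlgebra ℤ M.Group)).flip (MonoidAlgebra.of ℤ M.Group w) ∘ₗ
      (hD.canonicalHom.codRestrict (Algebra.adjoin ℤ (Set.range Dfam)) fun d ↦
        hD.range_canonicalHom ▸ ⟨d, rfl⟩).toLinearMap

include hπ

theorem demazureRep_factorMap_tmul (d : FD M)
    (hd : hD.canonicalHom d ∈ Algebra.adjoin ℤ (Set.range Dfam)) (w : M.Group) :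
    demazureRep M (M.Group →₀ FD M) (isIdempotentElem_egExt M)
      (factorMap π Dfam (⟨_, hd⟩ ⊗ₜ[ℤ] MonoidAlgebra.of ℤ M.Group w))
      (fun x ↦ Finsupp.single x⁻¹ 1) 1 = Finsupp.single w d := by
  rw [factorMap_tmul_of, map_mul, Module.End.mul_apply, hD.demazureRep_canonicalHom_apply_one,
    demazureRep_map _ hπ, translation_apply]
  simp

theorem factorMap_injective : Function.Injective (factorMap π Dfam) := by
  refine Function.LeftInverse.injective (g := fun a ↦ hD.tensorOfFinsupp
    (demazureRep M (M.Group →₀ FD M) (isIdempotentElem_egExt M) a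
      (fun x ↦ Finsupp.single x⁻¹ 1) 1)) fun z ↦ ?_
  induction z with
  | zero => simp
  | add x y hx hy =>
    simp only [map_add, LinearMap.add_apply, Pi.add_apply] at hx hy ⊢
    rw [hx, hy]
  | tmul d y =>
    induction y using MonoidAlgebra.induction_on with
    | of w =>
      obtain ⟨d, hd⟩ := d
      obtain ⟨d, rfl⟩ : d ∈ hD.canonicalHom.range := hD.range_canonicalHom ▸ hd
      dsimp only
      erw [hD.demazureRep_factorMap_tmul hπ]
      simp [tensorOfFinsupp]
      rfl
    | add x y hx hy =>
      simp only [TensorProduct.tmul_add, map_add, LinearMap.add_apply, Pi.add_apply] at hx hy ⊢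
      rw [hx, hy]
    | smul n x hx =>
      have hn : factorMap π Dfam (d ⊗ₜ[ℤ] (n • x)) = (n : HW M) * factorMap π Dfam (d ⊗ₜ[ℤ] x) := by
        rw [TensorProduct.tmul_smul, map_smul]
        exact zsmul_eq_mul _ n
      dsimp only at hx ⊢
      rw [hn, map_mul, map_intCast, Module.End.mul_apply, Module.End.intCast_apply,
        TensorProduct.tmul_smul]
      exact (map_smul hD.tensorOfFinsupp n _).trans (congrArg (n • ·) hx)

theorem mul_mem_range_factorMap (a : HW M) {b : HW M}
    (hb : b ∈ LinearMap.range (factorMap π Dfam)) :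
    a * b ∈ LinearMap.range (factorMap π Dfam) := by
  have hmem {d : HW M} (hd : d ∈ Algebra.adjoin ℤ (Set.range Dfam)) (w : M.Group) :
      d * π w ∈ LinearMap.range (factorMap π Dfam) :=
    ⟨⟨d, hd⟩ ⊗ₜ[ℤ] MonoidAlgebra.of ℤ M.Group w, factorMap_tmul_of _ w⟩
  have key {a : HW M} (ha : ∀ d ∈ Algebra.adjoin ℤ (Set.range Dfam), ∀ w,
      a * (d * π w) ∈ LinearMap.range (factorMap π Dfam)) {b : HW M}
      (hb : b ∈ LinearMap.range (factorMap π Dfam)) :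
      a * b ∈ LinearMap.range (factorMap π Dfam) := by
    obtain ⟨z, rfl⟩ := hb
    induction z with
    | zero => simp
    | add x y hx hy =>
      rw [map_add, mul_add]
      exact add_mem hx hy
    | tmul d y =>
      induction y using MonoidAlgebra.induction_on with
      | of w =>
        rw [factorMap_tmul_of]
        exact ha _ d.2 w
      | add x y hx hy =>
        rw [TensorProduct.tmul_add, map_add, mul_add]
        exact add_mem hx hy
      | smul n x hx =>
        rw [TensorProduct.tmul_smul, map_smul, mul_smul_comm]
        exact Submodule.smul_mem _ n hx
  induction a using induction_HW generalizing b with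
  | algebraMap n =>
    rw [← Algebra.smul_def]
    exact Submodule.smul_mem _ n hb
  | hs i =>
    refine key (fun d hd w ↦ ?_) hb
    obtain ⟨a, ha, c, hc, h⟩ := hD.hs_mul_mem_adjoin i hd
    rw [← mul_assoc, h, add_mul, mul_assoc, ← hπ, ← map_mul]
    exact add_mem (hmem ha _) (hmem hc _)
  | hD i =>
    refine key (fun d hd w ↦ ?_) hb
    rw [← mul_assoc, ← hD.simple i (M.toCoxeterSystem.isReflection_simple i)]
    exact hmem (mul_mem (Algebra.subset_adjoin ⟨_, rfl⟩) hd) w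
  | mul x y hx hy =>
    rw [mul_assoc]
    exact hx (hy hb)
  | add x y hx hy =>
    rw [add_mul]
    exact add_mem (hx hb) (hy hb)

theorem factorMap_surjective : Function.Surjective (factorMap π Dfam) := by
  intro a
  rw [← mul_one a]
  exact hD.mul_mem_range_factorMap hπ a
    ⟨1 ⊗ₜ[ℤ] MonoidAlgebra.of ℤ M.Group 1, by rw [factorMap_tmul_of, map_one]; simp⟩

end IsReflFamily

end Factorization

/-- For every Coxeter group `W`:  (1) the canonical homomorphism from the
algebra presented by generators `e_s` (`s ∈ 𝒮`) and relations `e_s² = e_s` to `Ĥ(W)`,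
`e_s ↦ D_s`, is injective, and its image is the subalgebra `D̂(W)` generated by the `D_s`;
(2) `Ĥ(W)` factors as `D̂(W)·ℤW`: the `ℤ`-linear map
`D̂(W) ⊗_ℤ ℤ[W] → Ĥ(W)`, `d ⊗ w ↦ d·π(w)`, is bijective. -/
theorem presentation_and_factorization {B : Type*} (M : CoxeterMatrix B)
    (π : M.Group →* (HW M)ˣ)
    (hπ : ∀ i : B, ((π (M.toCoxeterSystem.simple i) : (HW M)ˣ) : HW M) = hs M i)
    (Dfam : Refl M → HW M)
    (hD1 : ∀ (i : B) (h : M.toCoxeterSystem.IsReflection (M.toCoxeterSystem.simple i)),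
      Dfam ⟨M.toCoxeterSystem.simple i, h⟩ = hD M i)
    (hD2 : ∀ (i : B) (t : Refl M),
      (t : M.Group) ≠ M.toCoxeterSystem.simple i →
      ∀ h : M.toCoxeterSystem.IsReflection
          (M.toCoxeterSystem.simple i * (t : M.Group) * M.toCoxeterSystem.simple i),
        hs M i * Dfam t * hs M i =
          Dfam ⟨M.toCoxeterSystem.simple i * (t : M.Group) * M.toCoxeterSystem.simple i, h⟩) :
    (∃ φ : FD M →ₐ[ℤ] HW M,
      (∀ t : Refl M, φ (eg M t) = Dfam t) ∧
      Function.Injective φ ∧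
      φ.range = Algebra.adjoin ℤ (Set.range Dfam)) ∧
    (∃ μ : (Algebra.adjoin ℤ (Set.range Dfam)) ⊗[ℤ] (MonoidAlgebra ℤ M.Group) →ₗ[ℤ] HW M,
      (∀ (d : Algebra.adjoin ℤ (Set.range Dfam)) (w : M.Group),
        μ (d ⊗ₜ[ℤ] (MonoidAlgebra.of ℤ M.Group w)) = (d : HW M) * ((π w : (HW M)ˣ) : HW M)) ∧
      Function.Bijective μ) := by
  have hD : IsReflFamily M Dfam := ⟨hD1, hD2⟩
  have hπ' (i : B) : (Units.coeHom (HW M)).comp π (M.toCoxeterSystem.simple i) = hs M i := hπ i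
  exact ⟨⟨hD.canonicalHom, hD.canonicalHom_eg, hD.canonicalHom_injective, hD.range_canonicalHom⟩,
    factorMap ((Units.coeHom (HW M)).comp π) Dfam, factorMap_tmul_of,
    hD.factorMap_injective hπ', hD.factorMap_surjective hπ'⟩

end HeckeHopfCox
end
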